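/- Let s ≥ 0 be a real number and let (X, T) be a dynamical system with a metric d on X. Suppose there exist sequences of natural numbers (N_n), (M_n) and continuous maps ψ_n : [0,1]^{M_n} → X such that N_n → +∞, M_n/N_n → s as n → ∞, and ‖x − y‖_∞ ≤ d_{N_n}(ψ_n(x), ψ_n(y)) for all x, y ∈ [0,1]^{M_n}. Then for every natural number b and every equivariant continuous map π : (X, T) → (([0,1]^b)^ℤ, σ), the lower conditional metric mean dimension satisfies lower-mdim_M(π, T, d) ≥ s − b. -/

import Mathlib

open Filter Topology
open scoped ENNReal NNReal

noncomputable section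

/-- Diameter (in `ℝ≥0∞`) of a set with respect to a distance function `ρ`. -/
def setEDiam {X : Type*} (ρ : X → X → ℝ) (E : Set X) : ℝ≥0∞ :=
  ⨆ x ∈ E, ⨆ y ∈ E, ENNReal.ofReal (ρ x y)

/-- Openness with respect to a distance function `ρ`. -/
def ROpen {X : Type*} (ρ : X → X → ℝ) (U : Set X) : Prop :=
  ∀ x ∈ U, ∃ δ > 0, ∀ y, ρ x y < δ → y ∈ U

/-- `#(E, ρ, ε)`: the minimal number `n` of `ρ`-open sets of `ρ`-diameter `< ε` covering `E`
(`0` when `E = ∅`, since the empty family covers it). -/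
def covNum {X : Type*} (ρ : X → X → ℝ) (ε : ℝ) (E : Set X) : ℕ :=
  sInf {n : ℕ | ∃ U : Fin n → Set X, (∀ i, ROpen ρ (U i)) ∧
    (∀ i, setEDiam ρ (U i) < ENNReal.ofReal ε) ∧ E ⊆ ⋃ i, U i}

/-- The dynamical metric `d_N(x,y) = max_{0 ≤ n < N} d(Tⁿx, Tⁿy)`. -/
def dynDist {X : Type*} (T : X → X) (d : X → X → ℝ) (N : ℕ) (x y : X) : ℝ :=
  sSup {r : ℝ | ∃ n, n < N ∧ r = d (T^[n] x) (T^[n] y)}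

/-- `sup_{y ∈ Y} log #(π⁻¹(y), ρ, ε)`. -/
def supLogCov {X Y : Type*} (π : X → Y) (ρ : X → X → ℝ) (ε : ℝ) : ℝ :=
  ⨆ y : Y, Real.log (covNum ρ ε (π ⁻¹' {y}) : ℝ)

/-- `sup_{y ∈ Y} log #(π⁻¹(B_δ(y, ρY)), ρX, ε)` where `B_δ` is the closed `δ`-ball. -/
def supLogCovBall {X Y : Type*} (π : X → Y) (ρX : X → X → ℝ) (ρY : Y → Y → ℝ)
    (ε δ : ℝ) : ℝ :=
  ⨆ y : Y, Real.log (covNum ρX ε (π ⁻¹' {x | ρY x y ≤ δ}) : ℝ)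

/-- Topological conditional entropy
`h_top(π, T) = lim_{ε→0} lim_{N→∞} (sup_y log #(π⁻¹(y), d_N, ε))/N`, as an extended real. -/
def condEntropy {X Y : Type*} (π : X → Y) (T : X → X) (d : X → X → ℝ) : EReal :=
  Filter.limsup (fun ε : ℝ => Filter.liminf
      (fun N : ℕ => ((supLogCov π (dynDist T d N) ε / N : ℝ) : EReal)) Filter.atTop)
    (𝓝[>] (0 : ℝ))

/-- `lim_{N→∞} (sup_y log #(π⁻¹(y), d_N, ε))/(N log(1/ε))` (the limit exists by
subadditivity; it is realized here as a liminf). -/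
def condMdimRate {X Y : Type*} (π : X → Y) (T : X → X) (d : X → X → ℝ) (ε : ℝ) : EReal :=
  Filter.liminf (fun N : ℕ =>
    ((supLogCov π (dynDist T d N) ε / (N * Real.log (1 / ε)) : ℝ) : EReal)) Filter.atTop

/-- Lower conditional metric mean dimension of `π : (X,T,d) → Y`. -/
def lowerCondMdimM {X Y : Type*} (π : X → Y) (T : X → X) (d : X → X → ℝ) : EReal :=
  Filter.liminf (fun ε : ℝ => condMdimRate π T d ε) (𝓝[>] (0 : ℝ))

/-- Upper conditional metric mean dimension of `π : (X,T,d) → Y`. -/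
def upperCondMdimM {X Y : Type*} (π : X → Y) (T : X → X) (d : X → X → ℝ) : EReal :=
  Filter.limsup (fun ε : ℝ => condMdimRate π T d ε) (𝓝[>] (0 : ℝ))

/-- `lim_{N→∞} log #(X, d_N, ε)/(N log(1/ε))`. -/
def mdimMRate {X : Type*} (T : X → X) (d : X → X → ℝ) (ε : ℝ) : EReal :=
  Filter.liminf (fun N : ℕ =>
    ((Real.log (covNum (dynDist T d N) ε (Set.univ : Set X) : ℝ) /
      (N * Real.log (1 / ε)) : ℝ) : EReal)) Filter.atTop

/-- Lower metric mean dimension of `(X, T, d)`. -/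
def lowerMdimM {X : Type*} (T : X → X) (d : X → X → ℝ) : EReal :=
  Filter.liminf (fun ε : ℝ => mdimMRate T d ε) (𝓝[>] (0 : ℝ))

/-- Upper metric mean dimension of `(X, T, d)`. -/
def upperMdimM {X : Type*} (T : X → X) (d : X → X → ℝ) : EReal :=
  Filter.limsup (fun ε : ℝ => mdimMRate T d ε) (𝓝[>] (0 : ℝ))

/-- `widim_ε(X, ρ)`: the minimal `k` such that there are a finite simplicial complex of
dimension `≤ k` (realized in some `ℝ^m`) and a continuous `ε`-embedding `f : X → P`
(all fibers of `f` have `ρ`-diameter `< ε`). -/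
def widim (X : Type*) [TopologicalSpace X] (ρ : X → X → ℝ) (ε : ℝ) : ℕ :=
  sInf {k : ℕ | ∃ (m : ℕ) (K : Geometry.SimplicialComplex ℝ (Fin m → ℝ)),
    K.faces.Finite ∧ (∀ s ∈ K.faces, s.card ≤ k + 1) ∧
    ∃ f : X → K.space, Continuous f ∧
      ∀ p : K.space, setEDiam ρ (f ⁻¹' {p}) < ENNReal.ofReal ε}

/-- Mean dimension `mdim(X, T) = lim_{ε→0} lim_{N→∞} widim_ε(X, d_N)/N`. -/
def mdim (X : Type*) [TopologicalSpace X] (T : X → X) (d : X → X → ℝ) : EReal :=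
  Filter.limsup (fun ε : ℝ => Filter.liminf
      (fun N : ℕ => (((widim X (dynDist T d N) ε : ℝ) / N : ℝ) : EReal)) Filter.atTop)
    (𝓝[>] (0 : ℝ))

/-- The cube `[0,1]^a`. -/
abbrev Cube (a : ℕ) := Fin a → unitInterval

/-- The full shift space `([0,1]^a)^ℤ`. -/
abbrev FullShift (a : ℕ) := ℤ → Cube a

/-- The shift map `σ((x_n)_n) = (x_{n+1})_n`. -/
def shift {α : Type*} (x : ℤ → α) : ℤ → α := fun n => x (n + 1)

/-- The `ℓ^∞`-distance on the cube `[0,1]^a`. -/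
def cubeDist {a : ℕ} (x y : Cube a) : ℝ :=
  ‖(fun i => (x i : ℝ)) - fun i => (y i : ℝ)‖

/-- The metric `D((x_n), (y_n)) = Σ_{n∈ℤ} 2^{-|n|} ‖x_n − y_n‖_∞` on the full shift. -/
def shiftDist {a : ℕ} (x y : FullShift a) : ℝ :=
  ∑' n : ℤ, (2 : ℝ) ^ (-|n|) * cubeDist (x n) (y n)

end

/-- `c` is a system of barycentric weights expressing `0` through the points `q i`. -/
def IsBary {ι E : Type*} [Fintype ι] [AddCommGroup E] [Module ℝ E] (q : ι → E) (c : ι → ℝ) :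
    Prop :=
  (∀ i, 0 ≤ c i) ∧ ∑ i, c i = 1 ∧ ∑ i, c i • q i = 0

theorem exists_move_to_boundary {ι : Type*} [Fintype ι] (c m : ι → ℝ) (hc : ∀ i, 0 ≤ c i)
    (hm : m ≠ 0) (hm0 : ∑ i, m i = 0) :
    ∃ r : ℝ, 0 ≤ r ∧ (∀ i, 0 ≤ c i + r * m i) ∧ ∃ k, m k < 0 ∧ c k + r * m k = 0 := by
  classical
  have hne : (Finset.univ.filter fun i => m i < 0).Nonempty := by
    by_contra h
    rw [Finset.not_nonempty_iff_eq_empty, Finset.filter_eq_empty_iff] at h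
    have h' : ∀ i, 0 ≤ m i := fun i => not_lt.1 (h (Finset.mem_univ i))
    apply hm
    ext i
    exact (Finset.sum_eq_zero_iff_of_nonneg fun i _ => h' i).1 hm0 i (Finset.mem_univ i)
  obtain ⟨k, hk, hmin⟩ := Finset.exists_min_image _ (fun i => c i / (-m i)) hne
  have hk : m k < 0 := by simpa using hk
  refine ⟨c k / (-m k), div_nonneg (hc k) (by linarith), fun i => ?_, k, hk, ?_⟩
  · by_cases hi : m i < 0
    · have h1 := hmin i (by simpa using hi)
      have h2 : c k / (-m k) * (-m i) ≤ c i := by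
        rwa [le_div_iff₀ (by linarith)] at h1
      linarith
    · have := mul_nonneg (div_nonneg (hc k) (by linarith : 0 ≤ -m k)) (not_lt.1 hi)
      linarith [hc i]
  · have := hk.ne
    field_simp
    ring

theorem IsBary.even_card {ι E : Type*} [Fintype ι] [AddCommGroup E] [Module ℝ E]
    [FiniteDimensional ℝ E] (hcard : Fintype.card ι = Module.finrank ℝ E + 2) (q : ι → E)
    (hgen : ∀ c, IsBary q c → ∀ i j, c i = 0 → c j = 0 → i = j)
    [DecidablePred fun k => ∃ c, IsBary q c ∧ c k = 0] :
    Even (Finset.univ.filter fun k => ∃ c, IsBary q c ∧ c k = 0).card := by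
  classical
  by_cases hex : ∃ k c, IsBary q c ∧ c k = 0
  swap
  · rw [Finset.filter_eq_empty_iff.2]
    · simp
    · intro k _ hk
      exact hex ⟨k, hk⟩
  obtain ⟨k0, c0, hc0, hk0⟩ := hex
  let f : (ι → ℝ) →ₗ[ℝ] E × ℝ :=
    (∑ i, (LinearMap.proj i : (ι → ℝ) →ₗ[ℝ] ℝ).smulRight (q i)).prod
      (∑ i, (LinearMap.proj i : (ι → ℝ) →ₗ[ℝ] ℝ))
  have hf : ∀ m, f m = (∑ i, m i • q i, ∑ i, m i) := by
    intro m
    simp [f]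
  have hker : LinearMap.ker f ≠ ⊥ := by
    apply LinearMap.ker_ne_bot_of_finrank_lt
    rw [Module.finrank_prod, Module.finrank_fintype_fun_eq_card, hcard, Module.finrank_self]
    omega
  have hadd : ∀ (c m : ι → ℝ) (r : ℝ), IsBary q c → f m = 0 → (∀ i, 0 ≤ c i + r * m i) →
      IsBary q fun i => c i + r * m i := by
    intro c m r hc hm hpos
    rw [hf, Prod.mk_eq_zero] at hm
    refine ⟨hpos, ?_, ?_⟩
    · rw [Finset.sum_add_distrib, ← Finset.mul_sum, hm.2, hc.2.1]; simp
    · simp only [add_smul, mul_smul]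
      rw [Finset.sum_add_distrib, ← Finset.smul_sum, hm.1, hc.2.2]; simp
  have hnz : ∀ m, f m = 0 → m k0 = 0 → m = 0 := by
    intro m hm hmk
    by_contra hm0
    have hs : ∑ i, m i = 0 := by
      have := hm; rw [hf, Prod.mk_eq_zero] at this; exact this.2
    obtain ⟨r, -, hpos, k, hk, hk'⟩ := exists_move_to_boundary c0 m hc0.1 hm0 hs
    have := hgen _ (hadd c0 m r hc0 hm hpos) k k0 hk' (by simp [hk0, hmk])
    rw [this, hmk] at hk
    exact lt_irrefl _ hk
  obtain ⟨m, hm, hmk⟩ : ∃ m, f m = 0 ∧ 0 < m k0 := by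
    obtain ⟨m, hm, hm0⟩ := (Submodule.ne_bot_iff _).1 hker
    have hm : f m = 0 := hm
    have : m k0 ≠ 0 := fun h => hm0 (hnz m hm h)
    rcases lt_or_gt_of_ne this with h | h
    · exact ⟨-m, by rw [map_neg, hm, neg_zero], by simpa using h⟩
    · exact ⟨m, hm, h⟩
  have hm0 : m ≠ 0 := fun h => by simp [h] at hmk
  have hs : ∑ i, m i = 0 := by
    have := hm; rw [hf, Prod.mk_eq_zero] at this; exact this.2
  obtain ⟨r, hr, hpos, k1, hk1, hk1'⟩ := exists_move_to_boundary c0 m hc0.1 hm0 hs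
  have hc1 := hadd c0 m r hc0 hm hpos
  have hne : k0 ≠ k1 := by rintro rfl; linarith
  have : (Finset.univ.filter fun k => ∃ c, IsBary q c ∧ c k = 0) = {k0, k1} := by
    ext k2
    simp only [Finset.mem_filter, Finset.mem_univ, true_and, Finset.mem_insert,
      Finset.mem_singleton]
    constructor
    · rintro ⟨c2, hc2, hk2⟩
      have hd : f (c2 - c0) = 0 := by
        rw [map_sub, hf, hf, hc2.2.1, hc2.2.2, hc0.2.1, hc0.2.2, sub_self]
      set t := c2 k0 / m k0 with ht
      have ht0 : 0 ≤ t := div_nonneg (hc2.1 _) hmk.le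
      have hz : c2 - c0 - t • m = 0 := by
        apply hnz
        · rw [map_sub, hd, map_smul, hm, smul_zero, sub_zero]
        · simp only [Pi.sub_apply, Pi.smul_apply, smul_eq_mul, hk0, ht]
          field_simp
          ring
      have hc2' : ∀ i, c2 i = c0 i + t * m i := by
        intro i
        have := congrFun hz i
        simp only [Pi.sub_apply, Pi.smul_apply, smul_eq_mul, Pi.zero_apply] at this
        linarith
      by_cases hmk2 : m k2 < 0
      · right
        have h1 := hpos k2
        have h2 := hc2.1 k1
        rw [hc2'] at hk2 h2
        have h3 : r ≤ t := by nlinarith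
        have h4 : t ≤ r := by nlinarith
        have h5 : t = r := le_antisymm h4 h3
        rw [h5] at hk2
        exact hgen _ hc1 k2 k1 hk2 hk1'
      · left
        rw [hc2'] at hk2
        have := mul_nonneg ht0 (not_lt.1 hmk2)
        have := hc0.1 k2
        exact hgen _ hc0 k2 k0 (by linarith) hk0
    · rintro (rfl | rfl)
      · exact ⟨c0, hc0, hk0⟩
      · exact ⟨_, hc1, hk1'⟩
  rw [this, Finset.card_pair hne]
  exact even_two

theorem even_card_of_involution {α : Type*} (S : Finset α) (f : α → α)
    (hmem : ∀ x ∈ S, f x ∈ S) (hne : ∀ x ∈ S, f x ≠ x) (hinv : ∀ x ∈ S, f (f x) = x) :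
    Even S.card := by
  have h : ∑ _x ∈ S, (1 : ZMod 2) = 0 :=
    Finset.sum_involution (fun x _ => f x) (fun _ _ => by decide) (fun x hx _ => hne x hx)
      (fun x hx => hmem x hx) (fun x hx => hinv x hx)
  rw [Finset.sum_const, nsmul_eq_mul, mul_one] at h
  exact (ZMod.natCast_eq_zero_iff_even).1 h

/-- The points `q i` have no barycentric combination equal to `0` supported on `s`. -/
def NoBary {ι E : Type*} [Fintype ι] [AddCommGroup E] [Module ℝ E] (q : ι → E) (s : Finset ι) :
    Prop :=
  ∀ c, IsBary q c → ¬ ∀ j, j ∉ s → c j = 0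

theorem isOpen_noBary {ι E : Type*} [Fintype ι] [NormedAddCommGroup E] [NormedSpace ℝ E]
    {Γ : Type*} [TopologicalSpace Γ] (q : Γ → ι → E) (hq : ∀ i, Continuous fun γ => q γ i)
    (s : Finset ι) : IsOpen {γ | NoBary (q γ) s} := by
  rw [← isClosed_compl_iff]
  let K := stdSimplex ℝ ι
  have : CompactSpace K := isCompact_iff_compactSpace.1 (isCompact_stdSimplex ℝ ι)
  let Z : Set (Γ × K) := {x | ∑ i, x.2.1 i • q x.1 i = 0 ∧ ∀ j, j ∉ s → x.2.1 j = 0}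
  have hZ : IsClosed Z := by
    have hev : ∀ i, Continuous fun x : Γ × K => x.2.1 i := fun i =>
      (continuous_apply i).comp (continuous_subtype_val.comp continuous_snd)
    have h1 : IsClosed {x : Γ × K | ∑ i, x.2.1 i • q x.1 i = 0} :=
      isClosed_eq (continuous_finsetSum _ fun i _ =>
        (hev i).smul ((hq i).comp continuous_fst)) continuous_const
    have h2 : IsClosed (⋂ j, ⋂ (_ : j ∉ s), {x : Γ × K | x.2.1 j = 0}) :=
      isClosed_iInter fun j => isClosed_iInter fun _ => isClosed_eq (hev j) continuous_const
    convert h1.inter h2 using 1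
    ext x
    simp [Z]
  convert isClosedMap_fst_of_compactSpace _ hZ using 1
  ext γ
  constructor
  · intro h
    by_contra h'
    refine h fun c hc hcs => h' ⟨(γ, ⟨c, hc.1, hc.2.1⟩), ⟨hc.2.2, hcs⟩, rfl⟩
  · rintro ⟨⟨γ, ⟨c, hc1, hc2⟩⟩, ⟨h1, h2⟩, rfl⟩ h
    exact h c ⟨hc1, hc2, h1⟩ h2

theorem dense_noBary {ι C E : Type*} [Fintype ι] [NormedAddCommGroup E]
    [NormedSpace ℝ E] [FiniteDimensional ℝ E] (g : ι → E) (A : ι → E →L[ℝ] E) (cl : ι → C)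
    (s : Finset ι) (hA : ∀ j ∈ s, A j = 0 ∨ Function.Surjective (A j))
    (hcl : ∀ i ∈ s, ∀ j ∈ s, A i ≠ 0 → A j ≠ 0 → cl i = cl j → i = j)
    (hcard : s.card ≤ Module.finrank ℝ E)
    (hfix : ∀ c, IsBary g c → ¬ ∀ j, c j ≠ 0 → j ∈ s ∧ A j = 0) :
    Dense {γ : C → E | NoBary (fun j => g j + A j (γ (cl j))) s} := by
  classical
  set F := s.filter fun j => A j = 0 with hF
  suffices H : ∀ u : Finset ι, u ⊆ s → (∀ j ∈ u, A j ≠ 0) →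
      Dense {γ : C → E | NoBary (fun j => g j + A j (γ (cl j))) (F ∪ u)} by
    have := H (s.filter fun j => A j ≠ 0) (Finset.filter_subset _ _)
      (fun j hj => (Finset.mem_filter.1 hj).2)
    rwa [hF, Finset.filter_union_filter_not_eq] at this
  intro u
  induction u using Finset.induction_on with
  | empty =>
    intro _ _
    convert dense_univ
    rw [Set.eq_univ_iff_forall]
    intro γ c hc hcs
    rw [Finset.union_empty] at hcs
    have hsupp : ∀ j, c j ≠ 0 → j ∈ s ∧ A j = 0 := fun j hj => by
      by_contra h
      exact hj (hcs j (by rwa [hF, Finset.mem_filter]))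
    refine hfix c ⟨hc.1, hc.2.1, ?_⟩ hsupp
    rw [← hc.2.2]
    refine Finset.sum_congr rfl fun j _ => ?_
    by_cases hj : c j = 0
    · simp [hj]
    · simp [(hsupp j hj).2]
  | insert v u hvu ih =>
    intro hus hu
    have hvs : v ∈ s := hus (Finset.mem_insert_self _ _)
    have hvA : A v ≠ 0 := hu v (Finset.mem_insert_self _ _)
    have hsurj : Function.Surjective (A v) := (hA v hvs).resolve_left hvA
    have ih := ih (fun j hj => hus (Finset.mem_insert_of_mem hj))
      (fun j hj => hu j (Finset.mem_insert_of_mem hj))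
    rw [dense_iff_inter_open]
    intro O hO hOne
    obtain ⟨γ, hγO, hγ⟩ := ih.inter_open_nonempty O hO hOne
    let t := F ∪ u
    have hvt : v ∉ t := by
      simp only [t, Finset.mem_union, not_or, hF, Finset.mem_filter, not_and]
      exact ⟨fun _ => hvA, hvu⟩
    have hts : insert v t ⊆ s := by
      intro j hj
      simp only [t, Finset.mem_insert, Finset.mem_union] at hj
      rcases hj with rfl | hj | hj
      · exact hvs
      · exact (Finset.mem_filter.1 hj).1
      · exact hus (Finset.mem_insert_of_mem hj)
    let q : ι → E := fun j => g j + A j (γ (cl j))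
    let P : Submodule ℝ E := Submodule.span ℝ (t.image q : Set E)
    have hP : P ≠ ⊤ := by
      intro h
      have h1 : Module.finrank ℝ P ≤ (t.image q).card := finrank_span_finset_le_card _
      rw [h, finrank_top] at h1
      have h2 := Finset.card_image_le (s := t) (f := q)
      have h3 := Finset.card_le_card hts
      rw [Finset.card_insert_of_notMem hvt] at h3
      omega
    have hPd : Dense ((P : Set E)ᶜ) := by
      rw [← interior_eq_empty_iff_dense_compl]
      by_contra h
      exact hP (Submodule.eq_top_of_nonempty_interior' P (Set.nonempty_iff_ne_empty.2 h))
    have hopen : IsOpenMap fun y => g v + A v y :=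
      (isOpenMap_add_left (g v)).comp ((A v).isOpenMap hsurj)
    have hd := hPd.preimage hopen
    have hup : Continuous fun y => Function.update γ (cl v) y :=
      continuous_const.update (cl v) continuous_id
    obtain ⟨y, hyO, hyP⟩ := hd.inter_open_nonempty _ (hO.preimage hup)
      ⟨γ (cl v), by simpa using hγO⟩
    refine ⟨_, hyO, ?_⟩
    have hsame : ∀ j ∈ t, A j (Function.update γ (cl v) y (cl j)) = A j (γ (cl j)) := by
      intro j hj
      by_cases hj0 : A j = 0
      · simp [hj0]
      · rw [Function.update_of_ne]
        intro h
        have := hcl j (hts (Finset.mem_insert_of_mem hj)) v hvs hj0 hvA h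
        exact hvt (this ▸ hj)
    intro c hc hcs
    rw [Finset.union_insert] at hcs
    have hc3 := hc.2.2
    have hsum : ∑ j, c j • (g j + A j (Function.update γ (cl v) y (cl j)))
        = c v • (g v + A v y) + ∑ j ∈ t, c j • q j := by
      rw [← Finset.sum_subset (Finset.subset_univ (insert v t)), Finset.sum_insert hvt]
      · congr 1
        · simp
        · exact Finset.sum_congr rfl fun j hj => by rw [hsame j hj]
      · intro j _ hj
        rw [hcs j hj, zero_smul]
    rw [hsum] at hc3
    have hmem : ∑ j ∈ t, c j • q j ∈ P := Submodule.sum_mem _ fun j hj =>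
      P.smul_mem _ (Submodule.subset_span (by
        simpa using ⟨j, hj, rfl⟩))
    by_cases hcv : c v = 0
    · refine hγ c ⟨hc.1, hc.2.1, ?_⟩ fun j hj => ?_
      · rw [hcv, zero_smul, zero_add] at hc3
        rw [← hc3]
        refine (Finset.sum_subset (Finset.subset_univ t) fun j _ hj => ?_).symm
        by_cases hjv : j = v
        · rw [hjv, hcv, zero_smul]
        · rw [hcs j (by simp [hjv, t] at hj ⊢; exact hj), zero_smul]
      · by_cases hjv : j = v
        · rw [hjv, hcv]
        · exact hcs j (by simp [hjv] at hj ⊢; exact hj)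
    · apply hyP
      have : g v + A v y = -((c v)⁻¹ • ∑ j ∈ t, c j • q j) := by
        have h := congrArg (fun x => (c v)⁻¹ • x) hc3
        simp only [smul_add, smul_smul, inv_mul_cancel₀ hcv, one_smul, smul_zero] at h
        rw [eq_neg_iff_add_eq_zero]
        exact h
      show g v + A v y ∈ P
      rw [this]
      exact P.neg_mem (P.smul_mem _ hmem)

theorem dense_iInter_finset {α ι : Type*} [TopologicalSpace α] (s : Finset ι) (U : ι → Set α)
    (hU : ∀ i ∈ s, IsOpen (U i)) (hd : ∀ i ∈ s, Dense (U i)) : Dense (⋂ i ∈ s, U i) := by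
  classical
  induction s using Finset.induction_on with
  | empty => simp
  | insert a s ha ih =>
    rw [Finset.set_biInter_insert]
    exact (hd a (Finset.mem_insert_self _ _)).inter_of_isOpen_left
      (ih (fun i hi => hU i (Finset.mem_insert_of_mem hi))
        fun i hi => hd i (Finset.mem_insert_of_mem hi)) (hU a (Finset.mem_insert_self _ _))

/-- A family of signed involutive coordinate permutations, one for each coordinate; the one
attached to `a` negates the coordinate `a`. -/
structure FlipFamily (I : Type*) where
  τ : I → Equiv.Perm I
  ε : I → I → ℤ
  τ_invol : ∀ a i, τ a (τ a i) = i
  τ_self : ∀ a, τ a a = a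
  ε_self : ∀ a, ε a a = -1
  ε_eq : ∀ a i, ε a i = 1 ∨ ε a i = -1
  ε_τ : ∀ a i, ε a (τ a i) = ε a i

namespace FlipFamily

variable {I : Type*} (F : FlipFamily I)

/-- The flip on integer points. -/
def flipZ (a : I) (p : I → ℤ) : I → ℤ := fun i => F.ε a i * p (F.τ a i)

/-- The flip on real vectors. -/
def flipR (a : I) : (I → ℝ) →ₗ[ℝ] (I → ℝ) where
  toFun x := fun i => (F.ε a i : ℝ) * x (F.τ a i)
  map_add' x y := by ext i; simp [mul_add]
  map_smul' r x := by ext i; simp [mul_left_comm]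

theorem flipR_apply (a : I) (x : I → ℝ) (i : I) :
    F.flipR a x i = (F.ε a i : ℝ) * x (F.τ a i) := rfl

theorem ε_mul_ε (a i : I) : F.ε a i * F.ε a i = 1 := by
  rcases F.ε_eq a i with h | h <;> simp [h]

theorem abs_ε (a i : I) : |F.ε a i| = 1 := by
  rcases F.ε_eq a i with h | h <;> simp [h]

theorem abs_flipZ (a : I) (p : I → ℤ) (i : I) : |F.flipZ a p i| = |p (F.τ a i)| := by
  rw [flipZ, abs_mul, abs_ε, one_mul]

theorem flipZ_flipZ (a : I) (p : I → ℤ) : F.flipZ a (F.flipZ a p) = p := by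
  ext i
  simp only [flipZ, F.ε_τ, F.τ_invol]
  rw [← mul_assoc, F.ε_mul_ε, one_mul]

end FlipFamily

/-- Combinatorial data of a simplex in the triangulated prism over the grid cube: the odd
centre, the signs and the order in which the coordinates move. `none` is the time coordinate. -/
abbrev Chamber (I : Type*) [Fintype I] :=
  (I → ℤ) × (Option I → ℤ) × (Option I ≃ Fin (Fintype.card I + 1))

namespace Chamber

variable {I : Type*} [Fintype I]

/-- The time coordinate of the `k`-th vertex. -/
def time (c : Chamber I) (k : ℕ) : ℤ := 1 + if (c.2.2 none : ℕ) < k then c.2.1 none else 0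

/-- The space coordinates of the `k`-th vertex. -/
def pos (c : Chamber I) (k : ℕ) (a : I) : ℤ :=
  c.1 a + if (c.2.2 (some a) : ℕ) < k then c.2.1 (some a) else 0

/-- The chamber lies in the prism over the cube of size `N`. -/
def IsIn (N : ℤ) (c : Chamber I) : Prop :=
  (∀ a, Odd (c.1 a) ∧ |c.1 a| < N) ∧ ∀ x, c.2.1 x = 1 ∨ c.2.1 x = -1

theorem abs_pos_le {N : ℤ} {c : Chamber I} (hc : c.IsIn N) (k : ℕ) (a : I) : |c.pos k a| ≤ N := by
  have h1 := (hc.1 a).2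
  rw [abs_lt] at h1
  rw [abs_le, pos]
  rcases hc.2 (some a) with h | h <;> split_ifs <;> omega

theorem finite_isIn [DecidableEq I] (N : ℤ) : {c : Chamber I | c.IsIn N}.Finite := by
  refine Set.Finite.subset (Finset.finite_toSet ((Fintype.piFinset fun _ => Finset.Icc (-N) N) ×ˢ
    ((Fintype.piFinset fun _ => {1, -1}) ×ˢ (Finset.univ : Finset (Option I ≃ _))))) ?_
  intro c hc
  simp only [Finset.coe_product, Set.mem_prod, Finset.mem_coe, Fintype.mem_piFinset,
    Finset.mem_Icc, Finset.mem_insert, Finset.mem_singleton, Finset.mem_univ, and_true]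
  exact ⟨fun a => abs_le.1 (hc.1 a).2.le, hc.2⟩

/-- The chambers of the prism over the cube of size `N`. -/
noncomputable def all (I : Type*) [Fintype I] [DecidableEq I] (N : ℤ) : Finset (Chamber I) :=
  (finite_isIn N).toFinset

theorem mem_all [DecidableEq I] {N : ℤ} {c : Chamber I} : c ∈ all I N ↔ c.IsIn N := by
  simp [all]

/-- The values of `G` at the vertices of `c`. -/
def val (G : ℤ → (I → ℤ) → (I → ℝ)) (c : Chamber I) (j : Fin (Fintype.card I + 2)) : I → ℝ :=
  G (c.time j) (c.pos j)

/-- The facet of `c` opposite to the `k`-th vertex contains a zero of the affine extension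
of `G`. -/
def HasZero (G : ℤ → (I → ℤ) → (I → ℝ)) (c : Chamber I) (k : Fin (Fintype.card I + 2)) : Prop :=
  ∃ w, IsBary (c.val G) w ∧ w k = 0

theorem HasZero.of_linear {G : ℤ → (I → ℤ) → (I → ℝ)} {c c' : Chamber I}
    {k : Fin (Fintype.card I + 2)} (L : (I → ℝ) →ₗ[ℝ] (I → ℝ))
    (h : ∀ j, j ≠ k → c'.val G j = L (c.val G j)) (hc : c.HasZero G k) : c'.HasZero G k := by
  obtain ⟨w, hw, hk⟩ := hc
  refine ⟨w, ⟨hw.1, hw.2.1, ?_⟩, hk⟩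
  rw [← map_zero L, ← hw.2.2, map_sum]
  refine Finset.sum_congr rfl fun j _ => ?_
  by_cases hj : j = k
  · simp [hj, hk]
  · rw [h j hj, map_smul]

theorem HasZero.of_eq {G : ℤ → (I → ℤ) → (I → ℝ)} {c c' : Chamber I}
    {k : Fin (Fintype.card I + 2)}
    (h : ∀ j, j ≠ k → c'.time j = c.time j ∧ ∀ a, c'.pos j a = c.pos j a)
    (hc : c.HasZero G k) : c'.HasZero G k := by
  refine hc.of_linear LinearMap.id fun j hj => ?_
  rw [LinearMap.id_apply, val, val, (h j hj).1, funext (h j hj).2]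

variable [DecidableEq I] (G : ℤ → (I → ℤ) → (I → ℝ)) (N : ℤ)

open Classical in
theorem even_card_of_middle (k : Fin (Fintype.card I + 2)) (hk0 : k ≠ 0)
    (hk : (k : ℕ) ≤ Fintype.card I) :
    Even ((all I N).filter fun c => c.HasZero G k).card := by
  have hk0' : (k : ℕ) ≠ 0 := fun h => hk0 (Fin.ext h)
  let i : Fin (Fintype.card I + 1) := ⟨k - 1, by omega⟩
  let j : Fin (Fintype.card I + 1) := ⟨k, by omega⟩
  have hij : i ≠ j := by simp only [i, j, ne_eq, Fin.mk.injEq]; omega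
  have key : ∀ (x : Fin (Fintype.card I + 1)) (m : ℕ), m ≠ k →
      (((Equiv.swap i j x : Fin _) : ℕ) < m ↔ (x : ℕ) < m) := by
    intro x m hm
    by_cases h1 : x = i
    · rw [h1, Equiv.swap_apply_left]; simp only [i, j]; omega
    · by_cases h2 : x = j
      · rw [h2, Equiv.swap_apply_right]; simp only [i, j]; omega
      · rw [Equiv.swap_apply_of_ne_of_ne h1 h2]
  refine even_card_of_involution _ (fun c => (c.1, c.2.1, c.2.2.trans (Equiv.swap i j))) ?_ ?_ ?_
  · intro c hc
    rw [Finset.mem_filter, mem_all] at hc ⊢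
    refine ⟨hc.1, hc.2.of_eq fun m hm => ?_⟩
    have hm' : (m : ℕ) ≠ k := fun h => hm (Fin.ext h)
    simp only [time, pos, Equiv.trans_apply, key _ _ hm', implies_true, and_self]
  · intro c _ h
    have h1 : Equiv.swap i j (c.2.2 (c.2.2.symm i)) = c.2.2 (c.2.2.symm i) :=
      DFunLike.congr_fun (congrArg (fun c : Chamber I => c.2.2) h) (c.2.2.symm i)
    rw [Equiv.apply_symm_apply, Equiv.swap_apply_left] at h1
    exact hij h1.symm
  · intro c _
    ext <;> simp

open Classical in
theorem even_card_of_last :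
    Even ((all I N).filter fun c => c.HasZero G (Fin.last _)).card := by
  refine even_card_of_involution _ (fun c => (c.1,
    Function.update c.2.1 (c.2.2.symm (Fin.last _)) (-c.2.1 (c.2.2.symm (Fin.last _))), c.2.2))
    ?_ ?_ ?_
  · intro c hc
    rw [Finset.mem_filter, mem_all] at hc ⊢
    refine ⟨⟨hc.1.1, fun x => ?_⟩, hc.2.of_eq fun m hm => ?_⟩
    · by_cases hx : x = c.2.2.symm (Fin.last _)
      · subst hx
        simp only [Function.update_self]
        rcases hc.1.2 (c.2.2.symm (Fin.last _)) with h | h <;> simp [h]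
      · simp only [Function.update_of_ne hx]
        exact hc.1.2 x
    · have hm' : (m : ℕ) ≤ Fintype.card I := by
        have : (m : ℕ) ≠ Fintype.card I + 1 := fun h => hm (Fin.ext h)
        omega
      have key : ∀ x : Option I, (c.2.2 x : ℕ) < m → x ≠ c.2.2.symm (Fin.last _) := by
        rintro x hx rfl
        simp at hx
        omega
      refine ⟨?_, fun a => ?_⟩
      · simp only [time]
        split_ifs with h
        · rw [Function.update_of_ne (key _ h)]
        · rfl
      · simp only [pos]
        split_ifs with h
        · rw [Function.update_of_ne (key _ h)]
        · rfl
  · intro c hc h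
    rw [Finset.mem_filter, mem_all] at hc
    have h1 := congrFun (congrArg (fun c : Chamber I => c.2.1) h) (c.2.2.symm (Fin.last _))
    simp only [Function.update_self] at h1
    rcases hc.1.2 (c.2.2.symm (Fin.last _)) with h | h <;> omega
  · intro c _
    simp

open Classical in
theorem even_card_of_interior (a : I) :
    Even ((all I N).filter fun c => c.HasZero G 0 ∧ c.2.2 (some a) = 0 ∧
      |c.1 a + 2 * c.2.1 (some a)| < N).card := by
  refine even_card_of_involution _ (fun c =>
    (Function.update c.1 a (c.1 a + 2 * c.2.1 (some a)),
      Function.update c.2.1 (some a) (-c.2.1 (some a)), c.2.2)) ?_ ?_ ?_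
  · intro c hc
    rw [Finset.mem_filter, mem_all] at hc ⊢
    refine ⟨⟨fun x => ?_, fun x => ?_⟩, hc.2.1.of_eq fun m hm => ⟨?_, fun x => ?_⟩, hc.2.2.1, ?_⟩
    · by_cases hx : x = a
      · subst hx
        simp only [Function.update_self]
        exact ⟨(hc.1.1 x).1.add_even (even_two_mul _), hc.2.2.2⟩
      · simp only [Function.update_of_ne hx]
        exact hc.1.1 x
    · by_cases hx : x = some a
      · subst hx
        simp only [Function.update_self]
        rcases hc.1.2 (some a) with h | h <;> simp [h]
      · simp only [Function.update_of_ne hx]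
        exact hc.1.2 x
    · simp [time]
    · have hm' : 0 < (m : ℕ) := Nat.pos_of_ne_zero fun h => hm (Fin.ext h)
      by_cases hx : x = a
      · subst hx
        simp only [pos, Function.update_self, hc.2.2.1, Fin.val_zero, hm', if_true]
        ring
      · have : some x ≠ some a := fun h => hx (Option.some_injective _ h)
        simp only [pos, Function.update_of_ne hx, Function.update_of_ne this]
    · simp only [Function.update_self]
      have := (hc.1.1 a).2
      convert this using 2
      ring
  · intro c hc h
    rw [Finset.mem_filter, mem_all] at hc
    have h1 := congrFun (congrArg (fun c : Chamber I => c.2.1) h) (some a)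
    simp only [Function.update_self] at h1
    rcases hc.1.2 (some a) with h | h <;> omega
  · intro c _
    simp

open Classical in
theorem even_card_of_boundary (F : FlipFamily I) (hN : Even N)
    (hG : ∀ t p a, (∀ i, |p i| ≤ N) → |p a| = N → G t (F.flipZ a p) = F.flipR a (G t p)) (a : I) :
    Even ((all I N).filter fun c => c.HasZero G 0 ∧ c.2.2 (some a) = 0 ∧
      ¬ |c.1 a + 2 * c.2.1 (some a)| < N).card := by
  let f : Chamber I → Chamber I := fun c => (F.flipZ a c.1,
    fun x => x.elim (c.2.1 none) fun i => F.ε a i * c.2.1 (some (F.τ a i)),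
    (Equiv.optionCongr (F.τ a)).trans c.2.2)
  have htime : ∀ c k, (f c).time k = c.time k := by
    intro c k
    simp [f, time]
  have hpos : ∀ c k, (f c).pos k = F.flipZ a (c.pos k) := by
    intro c k
    ext i
    simp only [f, pos, FlipFamily.flipZ, Equiv.trans_apply, Equiv.optionCongr_apply,
      Option.map_some, Option.elim_some]
    split_ifs <;> ring
  refine even_card_of_involution _ f ?_ ?_ ?_
  · intro c hc
    rw [Finset.mem_filter, mem_all] at hc ⊢
    refine ⟨⟨fun x => ⟨?_, ?_⟩, fun x => ?_⟩, hc.2.1.of_linear (F.flipR a) fun m hm => ?_, ?_, ?_⟩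
    · rcases F.ε_eq a x with h | h
      · simpa [f, FlipFamily.flipZ, h] using (hc.1.1 (F.τ a x)).1
      · simpa [f, FlipFamily.flipZ, h] using (hc.1.1 (F.τ a x)).1
    · simp only [f, F.abs_flipZ]
      exact (hc.1.1 _).2
    · cases x with
      | none => exact hc.1.2 none
      | some i =>
        simp only [f, Option.elim_some]
        rcases F.ε_eq a i with h | h <;> rcases hc.1.2 (some (F.τ a i)) with h' | h' <;>
          simp [h, h']
    · rw [val, val, htime, hpos]
      apply hG _ _ _ (abs_pos_le hc.1 _)
      have hm' : 0 < (m : ℕ) := Nat.pos_of_ne_zero fun h => hm (Fin.ext h)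
      simp only [pos, hc.2.2.1, Fin.val_zero, hm', if_true]
      have h1 := hc.2.2.2
      have h2 := (hc.1.1 a).2
      obtain ⟨r, hr⟩ := (hc.1.1 a).1
      obtain ⟨r', hr'⟩ := hN
      rw [abs_lt] at h1 h2
      rw [abs_eq (by omega)]
      rcases hc.1.2 (some a) with h | h <;> rw [h] at h1 ⊢ <;> omega
    · simp [f, F.τ_self, hc.2.2.1]
    · intro h
      apply hc.2.2.2
      simp only [f, FlipFamily.flipZ, F.τ_self, F.ε_self, Option.elim_some] at h
      rw [← abs_neg]
      convert h using 2
      ring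
  · intro c hc h
    rw [Finset.mem_filter, mem_all] at hc
    have h1 := congrFun (congrArg (fun c : Chamber I => c.2.1) h) (some a)
    simp only [f, Option.elim_some, F.ε_self, F.τ_self] at h1
    rcases hc.1.2 (some a) with h | h <;> omega
  · intro c _
    refine Prod.ext (F.flipZ_flipZ a c.1) (Prod.ext ?_ ?_)
    · funext x
      cases x with
      | none => rfl
      | some i =>
        simp only [f, Option.elim_some, F.ε_τ, F.τ_invol]
        rw [← mul_assoc, F.ε_mul_ε, one_mul]
    · ext x
      cases x <;> simp [f, F.τ_invol]

open Classical in
theorem even_card_facets (F : FlipFamily I) (hN : Even N)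
    (hG : ∀ t p a, (∀ i, |p i| ≤ N) → |p a| = N → G t (F.flipZ a p) = F.flipR a (G t p))
    (hgen : ∀ c : Chamber I, c.IsIn N → ∀ w, IsBary (c.val G) w → ∀ i j, w i = 0 → w j = 0 →
      i = j) :
    Even ((all I N).filter fun c => c.HasZero G 0 ∧ c.2.2 none = 0).card := by
  have h1 : Even (∑ c ∈ all I N, (Finset.univ.filter fun k => c.HasZero G k).card) := by
    refine Finset.even_sum _ fun c hc => ?_
    exact IsBary.even_card (by simp) (c.val G) (hgen c (mem_all.1 hc))
  have h2 : ∑ c ∈ all I N, (Finset.univ.filter fun k => c.HasZero G k).card =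
      ∑ k, ((all I N).filter fun c => c.HasZero G k).card := by
    simp only [Finset.card_filter]
    exact Finset.sum_comm
  rw [h2, Fin.sum_univ_succ, Nat.even_add] at h1
  have h3 : Even ((all I N).filter fun c => c.HasZero G 0).card := by
    apply h1.2
    refine Finset.even_sum _ fun k _ => ?_
    by_cases hk : (k.succ : ℕ) ≤ Fintype.card I
    · exact even_card_of_middle G N _ (Fin.succ_ne_zero _) hk
    · have : k.succ = Fin.last _ := Fin.ext (by
        have := k.succ.isLt
        rw [Fin.val_last]
        omega)
      rw [this]
      exact even_card_of_last G N
  rw [Finset.card_eq_sum_card_fiberwise (f := fun c : Chamber I => c.2.2.symm 0)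
    (t := Finset.univ) (fun _ _ => Finset.mem_coe.2 (Finset.mem_univ _)), Fintype.sum_option,
    Nat.even_add] at h3
  have h4 : ∀ (c : Chamber I) x, c.2.2.symm 0 = x ↔ c.2.2 x = 0 := fun c x => by
    rw [Equiv.symm_apply_eq, eq_comm]
  simp only [Finset.filter_filter, h4] at h3
  apply h3.2
  refine Finset.even_sum _ fun a _ => ?_
  have h5 := (even_card_of_interior G N a).add (even_card_of_boundary G N F hN hG a)
  simp only [← and_assoc] at h5
  rw [← Finset.filter_filter, ← Finset.filter_filter (fun c => _ ∧ _)] at h5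
  rwa [Finset.card_filter_add_card_filter_not] at h5

end Chamber

namespace Chamber

variable {I : Type*} [Fintype I]

/-- The order of the coordinates in the unique chamber detected by `testMap`. -/
noncomputable def testOrder (I : Type*) [Fintype I] : Option I ≃ Fin (Fintype.card I + 1) :=
  (Equiv.optionCongr (Fintype.equivFin I)).trans (finSuccEquiv _).symm

theorem testOrder_none : testOrder I none = 0 := by
  simp [testOrder]

/-- Distinct small weights attached to the coordinates. -/
noncomputable def weight (x : Option I) : ℝ :=
  (testOrder I x : ℕ) / (2 * ((Fintype.card I : ℝ) + 2))

theorem weight_pos (a : I) : 0 < weight (some a) := by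
  have : testOrder I (some a) ≠ 0 := by
    rw [← testOrder_none]
    exact fun h => Option.some_ne_none _ ((testOrder I).injective h)
  have : 0 < (testOrder I (some a) : ℕ) := Nat.pos_of_ne_zero fun h => this (Fin.ext h)
  unfold weight; positivity

theorem weight_lt (x : Option I) : weight x < 1 / 2 := by
  unfold weight
  rw [div_lt_div_iff₀ (by positivity) (by norm_num)]
  have := (testOrder I x).isLt
  have h : ((testOrder I x : ℕ) : ℝ) < (Fintype.card I : ℝ) + 1 := by exact_mod_cast this
  linarith

theorem weight_lt_weight {x y : Option I} : weight x < weight y ↔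
    testOrder I x < testOrder I y := by
  unfold weight
  rw [div_lt_div_iff_of_pos_right (by positivity)]
  simp

open Classical in
/-- The indicator function of the interior of the grid cube. -/
noncomputable def inside (N : ℤ) (p : I → ℤ) : ℝ := if ∃ i, |p i| = N then 0 else 1

/-- The test map: the identity on the boundary of the grid cube, a small translation inside. -/
noncomputable def testMap (N : ℤ) (p : I → ℤ) (a : I) : ℝ :=
  p a - inside N p * weight (some a)

theorem testMap_flip (F : FlipFamily I) {N : ℤ} (p : I → ℤ) (a : I) (h : |p a| = N) :
    testMap N (F.flipZ a p) = F.flipR a (testMap N p) := by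
  ext i
  have h' : ∃ i, |F.flipZ a p i| = N := ⟨a, by rw [F.abs_flipZ, F.τ_self, h]⟩
  rw [FlipFamily.flipR_apply, testMap, testMap, inside, inside, if_pos h', if_pos ⟨a, h⟩]
  simp [FlipFamily.flipZ]

/-- The total weight of the vertices after the `r`-th. -/
noncomputable def tail {m : ℕ} (w : Fin m → ℝ) (r : ℕ) : ℝ := ∑ j : Fin m, if r < j then w j else 0

theorem tail_nonneg {m : ℕ} {w : Fin m → ℝ} (hw : ∀ j, 0 ≤ w j) (r : ℕ) : 0 ≤ tail w r :=
  Finset.sum_nonneg fun j _ => by split_ifs <;> simp [hw j]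

theorem tail_antitone {m : ℕ} {w : Fin m → ℝ} (hw : ∀ j, 0 ≤ w j) : Antitone (tail w) := by
  intro r r' h
  refine Finset.sum_le_sum fun j _ => ?_
  split_ifs
  · exact le_rfl
  · omega
  · exact hw j
  · exact le_rfl

theorem tail_le {m : ℕ} {w : Fin m → ℝ} (hw : ∀ j, 0 ≤ w j) (r : ℕ) : tail w r ≤ ∑ j, w j :=
  Finset.sum_le_sum fun j _ => by split_ifs <;> simp [hw j]

theorem tail_eq_sum {m : ℕ} {w : Fin m → ℝ} (r : ℕ) (h : ∀ j : Fin m, (j : ℕ) ≤ r → w j = 0) :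
    tail w r = ∑ j, w j := by
  refine Finset.sum_congr rfl fun j _ => ?_
  split_ifs with hj
  · rfl
  · exact (h j (not_lt.1 hj)).symm

theorem tail_eq_tail_succ {m : ℕ} {w : Fin m → ℝ} (j : Fin m) (r : ℕ) (hj : (j : ℕ) = r + 1)
    (h : w j = 0) : tail w r = tail w (r + 1) := by
  refine Finset.sum_congr rfl fun i _ => ?_
  by_cases hij : i = j
  · subst hij; simp [h]
  · have : (i : ℕ) ≠ r + 1 := fun h => hij (Fin.ext (h.trans hj.symm))
    simp only [show r < (i : ℕ) ↔ r + 1 < (i : ℕ) by omega]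

theorem testMap_analysis {N : ℤ} (hN : 4 ≤ N) {c : Chamber I} (hc : c.IsIn N)
    {w : Fin (Fintype.card I + 2) → ℝ}
    (hw : IsBary (fun j : Fin (Fintype.card I + 2) => testMap N (c.pos (j : ℕ))) w)
    (hsupp : ∀ j : Fin (Fintype.card I + 2), (j : ℕ) ≤ c.2.2 none → w j = 0) :
    (∀ a, c.1 a = 1 ∧ c.2.1 (some a) = -1) ∧ (∀ x, tail w (c.2.2 x) = 1 - weight x) ∧
      c.2.2 none = 0 ∧ ∀ j, j ≠ 0 → w j ≠ 0 := by
  obtain ⟨hw0, hw1, hw2⟩ := hw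
  set θ : Fin (Fintype.card I + 2) → ℝ := fun j => inside N (c.pos j) with hθ
  have hcoord : ∀ a, (c.1 a : ℝ) + c.2.1 (some a) * tail w (c.2.2 (some a)) =
      weight (some a) * ∑ j, w j * θ j := by
    intro a
    have h := congrFun hw2 a
    simp only [Finset.sum_apply, Pi.smul_apply, smul_eq_mul, Pi.zero_apply, testMap] at h
    rw [tail, Finset.mul_sum, Finset.mul_sum, ← mul_one (c.1 a : ℝ), ← hw1, Finset.mul_sum,
      ← Finset.sum_add_distrib, ← sub_eq_zero, ← Finset.sum_sub_distrib]
    refine Eq.trans (Finset.sum_congr rfl fun j _ => ?_) h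
    have : ((c.pos j a : ℤ) : ℝ) = c.1 a +
        if (c.2.2 (some a) : ℕ) < j then (c.2.1 (some a) : ℝ) else 0 := by
      rw [pos]
      split_ifs <;> push_cast <;> ring
    simp only [hθ, this]
    split_ifs <;> ring
  have hθ0 : 0 ≤ ∑ j, w j * θ j := Finset.sum_nonneg fun j _ =>
    mul_nonneg (hw0 j) (by simp only [hθ, inside]; split_ifs <;> norm_num)
  have hθ1 : ∑ j, w j * θ j ≤ 1 := by
    rw [← hw1]
    refine Finset.sum_le_sum fun j _ => mul_le_of_le_one_right (hw0 j) ?_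
    simp only [hθ, inside]; split_ifs <;> norm_num
  have hT0 := tail_nonneg hw0
  have hT1 : ∀ r, tail w r ≤ 1 := fun r => (tail_le hw0 r).trans_eq hw1
  have hone : ∀ a, c.1 a = 1 ∨ c.1 a = -1 := by
    intro a
    have h1 := weight_pos a
    have h2 := weight_lt (some a)
    have h3 : weight (some a) * ∑ j, w j * θ j < 1 / 2 :=
      (mul_le_of_le_one_right h1.le hθ1).trans_lt h2
    have h4 := mul_nonneg h1.le hθ0
    have h5 := hT0 (c.2.2 (some a))
    have h6 := hT1 (c.2.2 (some a))
    rw [← hcoord] at h3 h4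
    have h7 : ((c.1 a : ℤ) : ℝ) < 2 ∧ (-2 : ℝ) < c.1 a := by
      rcases hc.2 (some a) with h | h <;> rw [h] at h3 h4 <;> push_cast at h3 h4 <;>
        constructor <;> linarith
    have h8 : c.1 a < 2 ∧ -2 < c.1 a := ⟨by exact_mod_cast h7.1, by exact_mod_cast h7.2⟩
    obtain ⟨r, hr⟩ := (hc.1 a).1
    omega
  have hsmall : ∀ j : ℕ, ¬ ∃ i, |c.pos j i| = N := by
    rintro j ⟨i, hi⟩
    have : |c.pos j i| ≤ 2 := by
      rw [abs_le, pos]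
      rcases hone i with h | h <;> rcases hc.2 (some i) with h' | h' <;> rw [h, h'] <;>
        split_ifs <;> omega
    omega
  have hθsum : ∑ j, w j * θ j = 1 := by
    rw [← hw1]
    refine Finset.sum_congr rfl fun j _ => ?_
    simp [hθ, inside, hsmall]
  simp only [hθsum, mul_one] at hcoord
  have hnone : c.2.2 none = 0 := by
    by_contra hne
    obtain ⟨a, ha⟩ : ∃ a, c.2.2 (some a) = 0 := by
      rcases h : c.2.2.symm 0 with _ | a
      · exact absurd ((Equiv.symm_apply_eq _).1 h).symm hne
      · exact ⟨a, ((Equiv.symm_apply_eq _).1 h).symm⟩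
    have h1 : tail w (c.2.2 (some a)) = 1 := by
      rw [tail_eq_sum, hw1]
      intro j hj
      rw [ha, Fin.val_zero] at hj
      exact hsupp j (by omega)
    have h2 := hcoord a
    have h3 := weight_pos a
    have h4 := weight_lt (some a)
    rw [h1] at h2
    rcases hone a with h | h <;> rcases hc.2 (some a) with h' | h' <;> rw [h, h'] at h2 <;>
      norm_num at h2 <;> linarith
  have hos : ∀ a, c.1 a = 1 ∧ c.2.1 (some a) = -1 := by
    intro a
    have h2 := hcoord a
    have h3 := weight_pos a
    have h4 := weight_lt (some a)
    have h5 := hT0 (c.2.2 (some a))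
    have h6 := hT1 (c.2.2 (some a))
    rcases hone a with h | h <;> rcases hc.2 (some a) with h' | h' <;> rw [h, h'] at h2 <;>
      push_cast at h2 <;> first | exact ⟨h, h'⟩ | (exfalso; linarith)
  have htail : ∀ x, tail w (c.2.2 x) = 1 - weight x := by
    intro x
    cases x with
    | none =>
      rw [tail_eq_sum _ hsupp, hw1]
      simp [weight, testOrder_none]
    | some a =>
      have h := hcoord a
      rw [(hos a).1, (hos a).2] at h
      push_cast at h
      linarith
  refine ⟨hos, htail, hnone, fun j hj0 hj => ?_⟩
  have hj0' : (j : ℕ) ≠ 0 := fun h => hj0 (Fin.ext h)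
  have h1 := tail_eq_tail_succ j (j - 1) (by omega) hj
  have h2 := htail (c.2.2.symm ⟨j - 1, by omega⟩)
  simp only [Equiv.apply_symm_apply] at h2
  by_cases hjl : (j : ℕ) ≤ Fintype.card I
  · have h3 := htail (c.2.2.symm ⟨j - 1 + 1, by omega⟩)
    simp only [Equiv.apply_symm_apply] at h3
    have h4 : weight (c.2.2.symm ⟨j - 1, by omega⟩) =
        weight (c.2.2.symm ⟨j - 1 + 1, by omega⟩) := by
      linarith
    have h5 : testOrder I (c.2.2.symm ⟨j - 1, by omega⟩) =
        testOrder I (c.2.2.symm ⟨j - 1 + 1, by omega⟩) :=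
      le_antisymm (not_lt.1 fun h => (weight_lt_weight.2 h).ne' h4)
        (not_lt.1 fun h => (weight_lt_weight.2 h).ne h4)
    have h6 := c.2.2.symm.injective ((testOrder I).injective h5)
    simp at h6
  · have h3 : tail w ((j : ℕ) - 1 + 1) = 0 := by
      refine Finset.sum_eq_zero fun i _ => ?_
      rw [if_neg]
      omega
    have h4 := weight_lt (c.2.2.symm ⟨j - 1, by omega⟩)
    linarith

/-- The chamber detected by `testMap`. -/
noncomputable def testChamber (I : Type*) [Fintype I] : Chamber I :=
  (fun _ => 1, fun x => x.elim 1 fun _ => -1, testOrder I)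

theorem testChamber_isIn {N : ℤ} (hN : 4 ≤ N) : (testChamber I).IsIn N := by
  refine ⟨fun a => ⟨odd_one, by simp [testChamber]; omega⟩, fun x => ?_⟩
  cases x <;> simp [testChamber]

theorem sum_range_telescope (f : ℕ → ℝ) (r m : ℕ) :
    ∑ j ∈ Finset.range (m + 1), (if r < j then f (j - 1) - f j else 0) =
      if r < m then f r - f m else 0 := by
  induction m with
  | zero => simp
  | succ m ih =>
    rw [Finset.sum_range_succ, ih]
    by_cases h : r < m
    · simp [h, show r < m + 1 by omega]
    · by_cases h' : r = m
      · subst h'; simp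
      · simp [h, show ¬ r < m + 1 by omega]

theorem exists_bary_testChamber {N : ℤ} (hN : 4 ≤ N) :
    ∃ w, IsBary (fun j : Fin (Fintype.card I + 2) => testMap N ((testChamber I).pos (j : ℕ))) w ∧
      w 0 = 0 := by
  classical
  let f : ℕ → ℝ := fun r =>
    if r ≤ Fintype.card I then 1 - r / (2 * ((Fintype.card I : ℝ) + 2)) else 0
  have hf0 : f 0 = 1 := by simp [f]
  have hfl : f (Fintype.card I + 1) = 0 := by simp [f]
  have hf : ∀ r, f (r + 1) ≤ f r := by
    intro r
    simp only [f]
    split_ifs with h h' h'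
    · gcongr; omega
    · omega
    · have h2 : (r : ℝ) ≤ Fintype.card I := by exact_mod_cast h'
      rw [sub_nonneg, div_le_one (by positivity)]
      have : (0 : ℝ) ≤ (Fintype.card I : ℝ) := Nat.cast_nonneg _
      linarith
    · exact le_rfl
  let w : Fin (Fintype.card I + 2) → ℝ := fun j => f (j - 1) - f j
  have hw0 : w 0 = 0 := by simp [w]
  have hw : ∀ j, 0 ≤ w j := by
    intro j
    rcases Nat.eq_zero_or_pos (j : ℕ) with h | h
    · simp [w, h]
    · have := hf (j - 1)
      rw [Nat.sub_add_cancel h] at this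
      exact sub_nonneg.2 this
  have htail : ∀ r, r ≤ Fintype.card I → tail w r = f r := by
    intro r hr
    have h := sum_range_telescope f r (Fintype.card I + 1)
    rw [if_pos (by omega), hfl, sub_zero, Finset.sum_range] at h
    exact h
  have hsum : ∑ j, w j = 1 := by
    rw [← tail_eq_sum 0, htail 0 (Nat.zero_le _), hf0]
    intro j hj
    have : j = 0 := Fin.ext (Nat.le_zero.1 hj)
    rw [this, hw0]
  refine ⟨w, ⟨hw, hsum, ?_⟩, hw0⟩
  have hsmall : ∀ j : ℕ, ¬ ∃ i, |(testChamber I).pos j i| = N := by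
    rintro j ⟨i, hi⟩
    have : |(testChamber I).pos j i| ≤ 2 := by
      have : (testChamber I).pos j i = 1 + if (testOrder I (some i) : ℕ) < j then -1 else 0 := rfl
      rw [this]
      split_ifs <;> norm_num
    omega
  ext a
  have h1 : tail w (testOrder I (some a)) = 1 - weight (some a) := by
    have h := Nat.lt_succ_iff.1 (testOrder I (some a)).isLt
    rw [htail _ h]
    simp only [f, if_pos h, weight]
  have h0 : ∀ j, testMap N ((testChamber I).pos j) a = (((1 : ℤ) +
      if (testOrder I (some a) : ℕ) < j then -1 else 0 : ℤ) : ℝ) - weight (some a) := by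
    intro j
    rw [testMap, inside, if_neg (hsmall j), one_mul]
    rfl
  simp only [Finset.sum_apply, Pi.smul_apply, smul_eq_mul, Pi.zero_apply, h0]
  have h2 : ∑ j : Fin (Fintype.card I + 2), w j * ((((1 : ℤ) +
      if (testOrder I (some a) : ℕ) < j then -1 else 0 : ℤ) : ℝ) - weight (some a)) =
      (1 - weight (some a)) * ∑ j, w j - tail w (testOrder I (some a)) := by
    rw [tail, Finset.mul_sum, ← Finset.sum_sub_distrib]
    refine Finset.sum_congr rfl fun j _ => ?_
    split_ifs <;> push_cast <;> ring
  rw [h2, hsum, h1]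
  ring

variable [DecidableEq I]

open Classical in
/-- A map on the prism which equals `testMap` on the top has a zero in some bottom simplex. -/
theorem exists_bottom (F : FlipFamily I) {N : ℤ} (hN : Even N) (hN4 : 4 ≤ N)
    (G : ℤ → (I → ℤ) → (I → ℝ)) (hmap : ∀ p, G 2 p = testMap N p)
    (hG : ∀ t p a, (∀ i, |p i| ≤ N) → |p a| = N → G t (F.flipZ a p) = F.flipR a (G t p))
    (hgen : ∀ c : Chamber I, c.IsIn N → ∀ w, IsBary (c.val G) w → ∀ i j, w i = 0 → w j = 0 →
      i = j) :
    ∃ c : Chamber I, c.IsIn N ∧ c.HasZero G 0 ∧ c.2.2 none = 0 ∧ c.2.1 none = -1 := by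
  by_contra hno
  have heven := even_card_facets G N F hN hG hgen
  have hsuff : (all I N).filter (fun c => c.HasZero G 0 ∧ c.2.2 none = 0) =
      {testChamber I} := by
    have hval : ∀ c : Chamber I, c.2.2 none = 0 → c.2.1 none = 1 →
        ∀ j : Fin (Fintype.card I + 2), j ≠ 0 → c.val G j = testMap N (c.pos (j : ℕ)) := by
      intro c h0 h1 j hj
      have : 0 < (j : ℕ) := Nat.pos_of_ne_zero fun h => hj (Fin.ext h)
      simp only [val, time, h0, h1, Fin.val_zero, this, if_true]
      exact hmap _
    have htrans : ∀ (w : Fin (Fintype.card I + 2) → ℝ) (q q' : Fin (Fintype.card I + 2) → I → ℝ),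
        w 0 = 0 → (∀ j, j ≠ 0 → q j = q' j) → IsBary q w → IsBary q' w := by
      intro w q q' hw h hq
      refine ⟨hq.1, hq.2.1, ?_⟩
      rw [← hq.2.2]
      refine Finset.sum_congr rfl fun j _ => ?_
      by_cases hj : j = 0
      · simp [hj, hw]
      · rw [h j hj]
    ext c
    rw [Finset.mem_filter, mem_all, Finset.mem_singleton]
    constructor
    · rintro ⟨hc, ⟨w, hw, hw0⟩, hnone⟩
      have hs : c.2.1 none = 1 := (hc.2 none).resolve_right fun h =>
        hno ⟨c, hc, ⟨w, hw, hw0⟩, hnone, h⟩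
      have hw' := htrans w _ _ hw0 (hval c hnone hs) hw
      obtain ⟨hos, htail, -, -⟩ := testMap_analysis hN4 hc hw' (by
        intro j hj
        rw [hnone] at hj
        have : j = 0 := Fin.ext (Nat.le_zero.1 hj)
        rw [this, hw0])
      refine Prod.ext (funext fun a => (hos a).1) (Prod.ext (funext fun x => ?_) ?_)
      · cases x with
        | none => exact hs
        | some a => exact (hos a).2
      · have hmono : StrictMono (((testOrder I).symm.trans c.2.2 : Equiv.Perm _) : _ → _) := by
          intro i j hij
          by_contra hle
          have h1 := tail_antitone hw'.1 (Fin.val_fin_le.2 (not_lt.1 hle))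
          simp only [Equiv.trans_apply] at h1
          rw [htail, htail] at h1
          have h2 : weight ((testOrder I).symm i) < weight ((testOrder I).symm j) := by
            rw [weight_lt_weight]
            simpa using hij
          linarith
        have hid : ((testOrder I).symm.trans c.2.2 : Equiv.Perm _) = Equiv.refl _ := by
          ext i : 1
          exact DFunLike.congr_fun (Subsingleton.elim
            (StrictMono.orderIsoOfSurjective _ hmono (Equiv.surjective _))
            (OrderIso.refl (Fin (Fintype.card I + 1)))) i
        ext x : 1
        have h := DFunLike.congr_fun hid (testOrder I x)
        simpa [testChamber] using h
    · rintro rfl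
      refine ⟨testChamber_isIn hN4, ?_, by simp [testChamber, testOrder_none]⟩
      obtain ⟨w, hw, hw0⟩ := exists_bary_testChamber (I := I) hN4
      exact ⟨w, htrans w _ _ hw0 (fun j hj => (hval (testChamber I)
        (by simp [testChamber, testOrder_none]) rfl j hj).symm) hw, hw0⟩
  rw [hsuff] at heven
  simp at heven

omit [DecidableEq I] in
theorem vertex_injective {N : ℤ} {c : Chamber I} (hc : c.IsIn N)
    {i j : Fin (Fintype.card I + 2)} (hpos : c.pos i = c.pos j) (htime : c.time i = c.time j) :
    i = j := by
  wlog hij : i < j generalizing i j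
  · rcases lt_trichotomy i j with h | h | h
    · exact absurd h hij
    · exact h
    · exact (this hpos.symm htime.symm h).symm
  exfalso
  have hij' : (i : ℕ) < j := hij
  obtain ⟨x, hx⟩ : ∃ x, (c.2.2 x : ℕ) = i := ⟨c.2.2.symm ⟨i, by omega⟩, by simp⟩
  have hs := hc.2 x
  cases x with
  | none =>
    simp only [time, hx, hij', lt_irrefl, if_true, if_false] at htime
    omega
  | some a =>
    have := congrFun hpos a
    simp only [pos, hx, hij', lt_irrefl, if_true, if_false] at this
    omega

end Chamber

/-- A labelling of grid points by classes, together with linear maps, adapted to the flips: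
perturbations depending only on the class remain equivariant. -/
structure FlipClasses {I : Type*} (F : FlipFamily I) (N : ℤ) where
  cl : (I → ℤ) → (I → ℤ)
  A : (I → ℤ) → (I → ℝ) →L[ℝ] (I → ℝ)
  surj : ∀ p, Function.Surjective (A p)
  cl_flip : ∀ p a, (∀ i, |p i| ≤ N) → |p a| = N → cl (F.flipZ a p) = cl p
  A_flip : ∀ p a, (∀ i, |p i| ≤ N) → |p a| = N → ∀ y, A (F.flipZ a p) y = F.flipR a (A p y)
  cl_inj : ∀ p q, (∀ i, |p i| ≤ N) → (∀ i, |q i| ≤ N) → (∀ i, |p i - q i| ≤ 1) → cl p = cl q → p = q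

/-- A map on a grid which is equivariant on the boundary and oscillates little takes a small
value. -/
theorem FlipClasses.exists_small {I : Type*} [Fintype I] {F : FlipFamily I} {N : ℤ}
    (C : FlipClasses F N) (hN : Even N) (hN4 : 4 ≤ N) (g : (I → ℤ) → (I → ℝ))
    (hg : ∀ p a, (∀ i, |p i| ≤ N) → |p a| = N → g (F.flipZ a p) = F.flipR a (g p))
    {η : ℝ} (hη : 0 < η)
    (hosc : ∀ p q, (∀ i, |p i| ≤ N) → (∀ i, |q i| ≤ N) → (∀ i, |p i - q i| ≤ 1) →
      ‖g p - g q‖ ≤ η) :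
    ∃ p, (∀ i, |p i| ≤ N) ∧ ‖g p‖ ≤ 2 * η := by
  classical
  rcases isEmpty_or_nonempty I with hI | hI
  · refine ⟨fun _ => 0, fun i => hI.elim i, ?_⟩
    rw [Subsingleton.elim (g fun _ => 0) 0, norm_zero]
    positivity
  let Γ := (I → ℤ) × ℤ → (I → ℝ)
  let G : Γ → ℤ → (I → ℤ) → (I → ℝ) := fun γ t p =>
    if t = 2 then Chamber.testMap N p else g p + C.A p (γ (C.cl p, t))
  let Good : Chamber I × Fin (Fintype.card I + 2) × Fin (Fintype.card I + 2) → Set Γ := fun x =>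
    {γ | NoBary (x.1.val (G γ)) ({x.2.1, x.2.2} : Finset _)ᶜ}
  let S := ((Chamber.all I N) ×ˢ (Finset.univ ×ˢ Finset.univ)).filter
    fun x : Chamber I × Fin (Fintype.card I + 2) × Fin (Fintype.card I + 2) => x.2.1 ≠ x.2.2
  have hopen : ∀ x ∈ S, IsOpen (Good x) := by
    intro x _
    refine isOpen_noBary (fun γ => x.1.val (G γ)) (fun i => ?_) _
    simp only [Chamber.val, G]
    split_ifs
    · exact continuous_const
    · exact continuous_const.add ((C.A _).continuous.comp (continuous_apply _))
  have hdense : ∀ x ∈ S, Dense (Good x) := by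
    rintro ⟨c, i, j⟩ hx
    simp only [S, Finset.mem_filter, Finset.mem_product, Chamber.mem_all, Finset.mem_univ,
      and_true] at hx
    obtain ⟨hc, hij⟩ := hx
    have h := dense_noBary (C := (I → ℤ) × ℤ) (E := I → ℝ)
      (fun k : Fin (Fintype.card I + 2) =>
        if c.time k = 2 then Chamber.testMap N (c.pos k) else g (c.pos k))
      (fun k => if c.time k = 2 then 0 else C.A (c.pos k)) (fun k => (C.cl (c.pos k), c.time k))
      ({i, j} : Finset _)ᶜ ?_ ?_ ?_ ?_
    · refine h.mono fun γ hγ => ?_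
      have heq : c.val (G γ) = fun k : Fin (Fintype.card I + 2) =>
          (if c.time k = 2 then Chamber.testMap N (c.pos k) else g (c.pos k)) +
            (if c.time k = 2 then 0 else C.A (c.pos k))
            (γ (C.cl (c.pos k), c.time k)) := by
        funext k
        simp only [Chamber.val, G]
        split_ifs <;> simp
      show NoBary (c.val (G γ)) _
      rw [heq]
      exact hγ
    · intro k _
      split_ifs
      · exact Or.inl rfl
      · exact Or.inr (C.surj _)
    · intro k _ l _ hk hl hkl
      rw [Prod.mk.injEq] at hkl
      refine Chamber.vertex_injective hc (C.cl_inj _ _ (Chamber.abs_pos_le hc _)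
        (Chamber.abs_pos_le hc _) (fun a => ?_) hkl.1) hkl.2
      simp only [Chamber.pos]
      rw [abs_le]
      rcases hc.2 (some a) with h | h <;> split_ifs <;> omega
    · rw [Finset.card_compl, Finset.card_pair hij, Fintype.card_fin,
        Module.finrank_fintype_fun_eq_card]
      omega
    · intro w hw hsupp
      have hA : ∀ p, C.A p ≠ 0 := by
        intro p h
        obtain ⟨y, hy⟩ := C.surj p (fun _ => 1)
        rw [h] at hy
        have := congrFun hy (Classical.arbitrary I)
        simp at this
      have htime : ∀ k, w k ≠ 0 → c.2.1 none = 1 ∧ (c.2.2 none : ℕ) < k ∧ c.time k = 2 := by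
        intro k hk
        have h1 : c.time k = 2 := by
          by_contra h
          have := (hsupp k hk).2
          rw [if_neg h] at this
          exact hA _ this
        refine ⟨?_, ?_, h1⟩
        · simp only [Chamber.time] at h1
          split_ifs at h1 <;> omega
        · by_contra h
          simp only [Chamber.time, if_neg h] at h1
          omega
      have hw' : IsBary
          (fun k : Fin (Fintype.card I + 2) => Chamber.testMap N (c.pos (k : ℕ))) w := by
        refine ⟨hw.1, hw.2.1, ?_⟩
        rw [← hw.2.2]
        refine Finset.sum_congr rfl fun k _ => ?_
        by_cases hk : w k = 0
        · simp [hk]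
        · simp only [if_pos (htime k hk).2.2]
      obtain ⟨-, -, -, hne⟩ := Chamber.testMap_analysis hN4 hc hw' fun k hk => by
        by_contra h
        exact absurd (htime k h).2.1 (not_lt.2 hk)
      rcases eq_or_ne i 0 with hi | hi
      · have := (hsupp j (hne j fun h => hij (hi.trans h.symm))).1
        simp at this
      · have := (hsupp i (hne i hi)).1
        simp at this
  have hD := dense_iInter_finset S Good hopen hdense
  let B : Finset (I → ℤ) := Fintype.piFinset fun _ => Finset.Icc (-N) N
  let O : Set Γ := ⋂ p ∈ B, {γ | ‖C.A p (γ (C.cl p, 0))‖ < η}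
  have hO : IsOpen O := isOpen_biInter_finset fun p _ =>
    isOpen_lt ((C.A p).continuous.comp (continuous_apply _)).norm continuous_const
  obtain ⟨γ, hγO, hγ⟩ := hD.inter_open_nonempty O hO ⟨0, by
    simp only [O, Set.mem_iInter]
    intro p _
    show ‖C.A p 0‖ < η
    simpa using hη⟩
  simp only [O, Set.mem_iInter] at hγO
  simp only [Set.mem_iInter] at hγ
  obtain ⟨c, hc, ⟨w, hw, hw0⟩, hnone, hs⟩ := Chamber.exists_bottom F hN hN4 (G γ)
    (fun p => by simp [G]) (by
      intro t p a hp ha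
      simp only [G]
      split_ifs
      · exact Chamber.testMap_flip F p a ha
      · rw [hg p a hp ha, C.A_flip p a hp ha, C.cl_flip p a hp ha, map_add]) (by
      intro c hc w hw i j hi hj
      by_contra hij
      refine hγ (c, i, j) (by simp [S, Chamber.mem_all, hc, hij]) w hw fun k hk => ?_
      simp only [Finset.mem_compl, Finset.mem_insert, Finset.mem_singleton, not_not] at hk
      rcases hk with rfl | rfl
      · exact hi
      · exact hj)
  have hr := Chamber.abs_pos_le hc
  refine ⟨c.pos 1, hr 1, ?_⟩
  have hval : ∀ j : Fin (Fintype.card I + 2), j ≠ 0 →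
      c.val (G γ) j = g (c.pos j) + C.A (c.pos j) (γ (C.cl (c.pos j), 0)) := by
    intro j hj
    have : 0 < (j : ℕ) := Nat.pos_of_ne_zero fun h => hj (Fin.ext h)
    simp [Chamber.val, Chamber.time, hnone, hs, this, G]
  have h1 : g (c.pos 1) = ∑ j, w j • (g (c.pos 1) - c.val (G γ) j) := by
    simp only [smul_sub]
    rw [Finset.sum_sub_distrib, hw.2.2, sub_zero, ← Finset.sum_smul, hw.2.1, one_smul]
  rw [h1]
  calc ‖∑ j, w j • (g (c.pos 1) - c.val (G γ) j)‖
      ≤ ∑ j, w j * (2 * η) := by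
        refine (norm_sum_le _ _).trans (Finset.sum_le_sum fun j _ => ?_)
        rw [norm_smul, Real.norm_of_nonneg (hw.1 j)]
        by_cases hj : j = 0
        · simp [hj, hw0]
        · refine mul_le_mul_of_nonneg_left ?_ (hw.1 j)
          rw [hval j hj, ← sub_sub]
          refine (norm_sub_le _ _).trans ?_
          have h2 := hosc (c.pos 1) (c.pos j) (hr 1) (hr j) (fun a => by
            simp only [Chamber.pos]
            rw [abs_le]
            rcases hc.2 (some a) with h | h <;> split_ifs <;> omega)
          have h3 := hγO (c.pos j) (by
            simp only [B, Fintype.mem_piFinset, Finset.mem_Icc]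
            exact fun a => abs_le.1 (hr j a))
          have h3 : ‖C.A (c.pos j) (γ (C.cl (c.pos j), 0))‖ < η := h3
          linarith
    _ = 2 * η := by rw [← Finset.sum_mul, hw.2.1, one_mul]

namespace FlipFamily

variable {I : Type*}

/-- The flip family of a rooted binary tree, whose root carries `K` coordinates and whose two
subtrees carry the flip family `F`: root flips exchange the subtrees. -/
def node (K : ℕ) (F : FlipFamily I) : FlipFamily (Fin K ⊕ Bool × I) where
  τ a := match a with
    | .inl _ => Equiv.sumCongr (Equiv.refl _) (Equiv.prodCongr Equiv.boolNot (Equiv.refl _))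
    | .inr (b, a) => Equiv.sumCongr (Equiv.refl _)
        (Equiv.prodCongrRight fun b' => if b' = b then F.τ a else Equiv.refl _)
  ε a i := match a, i with
    | .inl _, .inl _ => -1
    | .inl _, .inr _ => 1
    | .inr _, .inl _ => 1
    | .inr (b, a), .inr (b', i) => if b' = b then F.ε a i else 1
  τ_invol a i := by
    rcases a with a | ⟨b, a⟩ <;> rcases i with i | ⟨b', i⟩ <;> simp
    by_cases h : b' = b <;> simp [h, F.τ_invol]
  τ_self a := by
    rcases a with a | ⟨b, a⟩ <;> simp [F.τ_self]
  ε_self a := by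
    rcases a with a | ⟨b, a⟩ <;> simp [F.ε_self]
  ε_eq a i := by
    rcases a with a | ⟨b, a⟩ <;> rcases i with i | ⟨b', i⟩ <;> simp
    by_cases h : b' = b <;> simp [h, F.ε_eq]
  ε_τ a i := by
    rcases a with a | ⟨b, a⟩ <;> rcases i with i | ⟨b', i⟩ <;> simp
    by_cases h : b' = b <;> simp [h, F.ε_τ]

/-- The flip family of the empty set of coordinates. -/
def empty : FlipFamily Empty where
  τ a := a.elim
  ε a := a.elim
  τ_invol a := a.elim
  τ_self a := a.elim
  ε_self a := a.elim
  ε_eq a := a.elim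
  ε_τ a := a.elim

variable {K : ℕ} (F : FlipFamily I)

theorem node_flipZ_inl_inl (p : Fin K ⊕ Bool × I → ℤ) (a i : Fin K) :
    (F.node K).flipZ (.inl a) p (.inl i) = - p (.inl i) := by
  simp [flipZ, node]

theorem node_flipZ_inl_inr (p : Fin K ⊕ Bool × I → ℤ) (a : Fin K) (i : Bool × I) :
    (F.node K).flipZ (.inl a) p (.inr i) = p (.inr (!i.1, i.2)) := by
  rcases i with ⟨b, i⟩
  simp [flipZ, node]

theorem node_flipZ_inr_inl (p : Fin K ⊕ Bool × I → ℤ) (a : Bool × I) (i : Fin K) :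
    (F.node K).flipZ (.inr a) p (.inl i) = p (.inl i) := by
  simp [flipZ, node]

theorem node_flipZ_inr_inr (p : Fin K ⊕ Bool × I → ℤ) (a i : Bool × I) :
    (F.node K).flipZ (.inr a) p (.inr i) =
      if i.1 = a.1 then F.flipZ a.2 (fun i' => p (.inr (i.1, i'))) i.2 else p (.inr i) := by
  rcases i with ⟨b, i⟩
  by_cases h : b = a.1 <;> simp [flipZ, node, h]

theorem node_flipR_inl_inl (p : Fin K ⊕ Bool × I → ℝ) (a i : Fin K) :
    (F.node K).flipR (.inl a) p (.inl i) = - p (.inl i) := by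
  simp [flipR_apply, node]

theorem node_flipR_inl_inr (p : Fin K ⊕ Bool × I → ℝ) (a : Fin K) (i : Bool × I) :
    (F.node K).flipR (.inl a) p (.inr i) = p (.inr (!i.1, i.2)) := by
  rcases i with ⟨b, i⟩
  simp [flipR_apply, node]

theorem node_flipR_inr_inl (p : Fin K ⊕ Bool × I → ℝ) (a : Bool × I) (i : Fin K) :
    (F.node K).flipR (.inr a) p (.inl i) = p (.inl i) := by
  simp [flipR_apply, node]

theorem node_flipR_inr_inr (p : Fin K ⊕ Bool × I → ℝ) (a i : Bool × I) :
    (F.node K).flipR (.inr a) p (.inr i) =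
      if i.1 = a.1 then F.flipR a.2 (fun i' => p (.inr (i.1, i'))) i.2 else p (.inr i) := by
  rcases i with ⟨b, i⟩
  by_cases h : b = a.1 <;> simp [flipR_apply, node, h]

end FlipFamily

open Classical in
/-- Whether a boundary point of the grid cube is smaller than its antipode. -/
noncomputable def antipodal {K : ℕ} (N : ℤ) (r : Fin K → ℤ) : Bool :=
  decide ((∃ i, |r i| = N) ∧ toLex r < toLex (-r))

theorem antipodal_iff {K : ℕ} {N : ℤ} {r : Fin K → ℤ} :
    antipodal N r = true ↔ (∃ i, |r i| = N) ∧ toLex r < toLex (-r) := by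
  simp only [antipodal, decide_eq_true_eq]

theorem antipodal_neg {K : ℕ} {N : ℤ} (hN : 1 ≤ N) {r : Fin K → ℤ} (h : ∃ i, |r i| = N) :
    antipodal N (-r) = !antipodal N r := by
  have h' : ∃ i, |(-r) i| = N := by simpa using h
  have hr : r ≠ -r := by
    rintro h0
    obtain ⟨i, hi⟩ := h
    have := congrFun h0 i
    simp only [Pi.neg_apply] at this
    have : r i = 0 := by omega
    rw [this] at hi
    simp at hi
    omega
  rcases lt_or_gt_of_ne (fun h => hr (toLex.injective h)) with hlt | hlt
  · have h1 : antipodal N r = true := antipodal_iff.2 ⟨h, hlt⟩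
    have h2 : ¬ antipodal N (-r) = true := fun h2 => by
      have := (antipodal_iff.1 h2).2
      rw [neg_neg] at this
      exact hlt.asymm this
    simpa [h1] using h2
  · have h1 : ¬ antipodal N r = true := fun h1 => hlt.asymm (antipodal_iff.1 h1).2
    have h2 : antipodal N (-r) = true := antipodal_iff.2 ⟨h', by rwa [neg_neg]⟩
    simpa [h2] using h1

/-- The sign `-1` for `true` and `1` for `false`. -/
def boolSign (s : Bool) : ℤ := if s then -1 else 1

theorem boolSign_not (s : Bool) : boolSign (!s) = - boolSign s := by cases s <;> simp [boolSign]

theorem boolSign_mul_self_real (s : Bool) (x : ℝ) : (boolSign s : ℝ) * (boolSign s * x) = x := by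
  cases s <;> simp [boolSign]

namespace FlipClasses

variable {I : Type*} {F : FlipFamily I} {N : ℤ}

/-- The restriction of a function on a tree to its root. -/
def root {R : Type*} {K : ℕ} (p : Fin K ⊕ Bool × I → R) : Fin K → R := fun i => p (.inl i)

/-- The restriction of a function on a tree to one of its subtrees. -/
def sub {R : Type*} {K : ℕ} (p : Fin K ⊕ Bool × I → R) (b : Bool) : I → R :=
  fun i => p (.inr (b, i))

theorem root_flip_inl {K : ℕ} (p : Fin K ⊕ Bool × I → ℤ) (a : Fin K) :
    root ((F.node K).flipZ (.inl a) p) = - root p := by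
  ext i; simp [root, F.node_flipZ_inl_inl]

theorem sub_flip_inl {K : ℕ} (p : Fin K ⊕ Bool × I → ℤ) (a : Fin K) (b : Bool) :
    sub ((F.node K).flipZ (.inl a) p) b = sub p (!b) := by
  ext i; simp [sub, F.node_flipZ_inl_inr]

theorem root_flip_inr {K : ℕ} (p : Fin K ⊕ Bool × I → ℤ) (a : Bool × I) :
    root ((F.node K).flipZ (.inr a) p) = root p := by
  ext i; simp [root, F.node_flipZ_inr_inl]

theorem sub_flip_inr {K : ℕ} (p : Fin K ⊕ Bool × I → ℤ) (a : Bool × I) (b : Bool) :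
    sub ((F.node K).flipZ (.inr a) p) b = if b = a.1 then F.flipZ a.2 (sub p b) else sub p b := by
  ext i
  by_cases h : b = a.1
  · simp [sub, F.node_flipZ_inr_inr, h]; rfl
  · simp [sub, F.node_flipZ_inr_inr, h]

theorem rootR_flip_inl {K : ℕ} (p : Fin K ⊕ Bool × I → ℝ) (a : Fin K) :
    root ((F.node K).flipR (.inl a) p) = - root p := by
  ext i; simp [root, F.node_flipR_inl_inl]

theorem subR_flip_inl {K : ℕ} (p : Fin K ⊕ Bool × I → ℝ) (a : Fin K) (b : Bool) :
    sub ((F.node K).flipR (.inl a) p) b = sub p (!b) := by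
  ext i; simp [sub, F.node_flipR_inl_inr]

theorem rootR_flip_inr {K : ℕ} (p : Fin K ⊕ Bool × I → ℝ) (a : Bool × I) :
    root ((F.node K).flipR (.inr a) p) = root p := by
  ext i; simp [root, F.node_flipR_inr_inl]

theorem subR_flip_inr {K : ℕ} (p : Fin K ⊕ Bool × I → ℝ) (a : Bool × I) (b : Bool) :
    sub ((F.node K).flipR (.inr a) p) b = if b = a.1 then F.flipR a.2 (sub p b) else sub p b := by
  ext i
  by_cases h : b = a.1
  · simp [sub, F.node_flipR_inr_inr, h]; rfl
  · simp [sub, F.node_flipR_inr_inr, h]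

theorem ext_tree {R : Type*} {K : ℕ} {p q : Fin K ⊕ Bool × I → R} (h : root p = root q)
    (h' : ∀ b, sub p b = sub q b) : p = q := by
  ext i
  rcases i with i | ⟨b, i⟩
  · exact congrFun h i
  · exact congrFun (h' b) i

/-- The underlying map of `nodeA`. -/
noncomputable def nodeFun {K : ℕ} (C : FlipClasses F N) (p : Fin K ⊕ Bool × I → ℤ)
    (y : Fin K ⊕ Bool × I → ℝ) : Fin K ⊕ Bool × I → ℝ :=
  Sum.elim (fun i => boolSign (antipodal N (root p)) * root y i)
    (fun i => C.A (sub p i.1) (sub y (xor i.1 (antipodal N (root p)))) i.2)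

theorem root_nodeFun {K : ℕ} (C : FlipClasses F N) (p : Fin K ⊕ Bool × I → ℤ)
    (y : Fin K ⊕ Bool × I → ℝ) :
    root (C.nodeFun p y) = fun i => boolSign (antipodal N (root p)) * root y i := rfl

theorem sub_nodeFun {K : ℕ} (C : FlipClasses F N) (p : Fin K ⊕ Bool × I → ℤ)
    (y : Fin K ⊕ Bool × I → ℝ) (b : Bool) :
    sub (C.nodeFun p y) b = C.A (sub p b) (sub y (xor b (antipodal N (root p)))) := rfl

/-- The canonical representative of a configuration on a tree. -/
noncomputable def nodeCl {K : ℕ} (C : FlipClasses F N) (p : Fin K ⊕ Bool × I → ℤ) :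
    Fin K ⊕ Bool × I → ℤ :=
  Sum.elim (fun i => boolSign (antipodal N (root p)) * root p i)
    (fun i => C.cl (sub p (xor i.1 (antipodal N (root p)))) i.2)

theorem root_nodeCl {K : ℕ} (C : FlipClasses F N) (p : Fin K ⊕ Bool × I → ℤ) :
    root (C.nodeCl p) = fun i => boolSign (antipodal N (root p)) * root p i := rfl

theorem sub_nodeCl {K : ℕ} (C : FlipClasses F N) (p : Fin K ⊕ Bool × I → ℤ) (b : Bool) :
    sub (C.nodeCl p) b = C.cl (sub p (xor b (antipodal N (root p)))) := rfl

variable [Fintype I]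

/-- The perturbation maps on a tree. -/
noncomputable def nodeA {K : ℕ} (C : FlipClasses F N) (p : Fin K ⊕ Bool × I → ℤ) :
    (Fin K ⊕ Bool × I → ℝ) →L[ℝ] (Fin K ⊕ Bool × I → ℝ) :=
  LinearMap.toContinuousLinearMap
    { toFun := C.nodeFun p
      map_add' := fun x y => by
        refine ext_tree ?_ fun b => ?_
        · ext i; simp [nodeFun, root, mul_add]
        · exact map_add (C.A (sub p b)) (sub x (xor b (antipodal N (root p))))
            (sub y (xor b (antipodal N (root p))))
      map_smul' := fun r x => by
        refine ext_tree ?_ fun b => ?_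
        · ext i; simp [nodeFun, root, mul_left_comm]
        · exact map_smul (C.A (sub p b)) r (sub x (xor b (antipodal N (root p)))) }

theorem nodeA_apply {K : ℕ} (C : FlipClasses F N) (p : Fin K ⊕ Bool × I → ℤ)
    (y : Fin K ⊕ Bool × I → ℝ) : C.nodeA p y = C.nodeFun p y := rfl

/-- The flip classes of a tree. -/
noncomputable def node (K : ℕ) (hN : 1 ≤ N) (C : FlipClasses F N) :
    FlipClasses (F.node K) N where
  cl := C.nodeCl
  A := C.nodeA
  surj p z := by
    choose f hf using fun b => C.surj (sub p b)
    refine ⟨Sum.elim (fun i => boolSign (antipodal N (root p)) * root z i)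
      (fun i => f (xor i.1 (antipodal N (root p))) (sub z (xor i.1 (antipodal N (root p)))) i.2),
      ext_tree ?_ fun b => ?_⟩
    · ext i
      exact boolSign_mul_self_real _ _
    · rw [nodeA_apply, sub_nodeFun]
      have := hf b (sub z b)
      convert this using 2
      ext i
      simp [sub]
  cl_flip p a hp ha := by
    rcases a with a | a
    · have h : antipodal N (-root p) = !antipodal N (root p) := antipodal_neg hN ⟨a, ha⟩
      refine ext_tree ?_ fun b => ?_
      · rw [root_nodeCl, root_nodeCl, root_flip_inl, h, boolSign_not]
        ext i; simp
      · rw [sub_nodeCl, sub_nodeCl, root_flip_inl, h, sub_flip_inl]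
        simp
    · refine ext_tree ?_ fun b => ?_
      · rw [root_nodeCl, root_nodeCl, root_flip_inr]
      · rw [sub_nodeCl, sub_nodeCl, root_flip_inr, sub_flip_inr]
        split_ifs with h
        · rw [h]
          exact C.cl_flip _ _ (fun i => hp _) ha
        · rfl
  A_flip p a hp ha y := by
    simp only [nodeA_apply]
    rcases a with a | a
    · have h : antipodal N (-root p) = !antipodal N (root p) := antipodal_neg hN ⟨a, ha⟩
      refine ext_tree ?_ fun b => ?_
      · rw [root_nodeFun, rootR_flip_inl, root_nodeFun, root_flip_inl, h, boolSign_not]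
        ext i; simp
      · rw [sub_nodeFun, subR_flip_inl, sub_nodeFun, root_flip_inl, h, sub_flip_inl]
        simp
    · refine ext_tree ?_ fun b => ?_
      · rw [root_nodeFun, rootR_flip_inr, root_nodeFun, root_flip_inr]
      · rw [sub_nodeFun, subR_flip_inr, sub_nodeFun, root_flip_inr, sub_flip_inr]
        split_ifs with h
        · subst h
          exact C.A_flip (sub p a.1) a.2 (fun i => hp _) ha _
        · rfl
  cl_inj p q hp hq hpq h := by
    have hs : antipodal N (root p) = antipodal N (root q) := by
      by_contra hs
      have h1 := congrArg root h
      have key : ∀ p q : Fin K ⊕ Bool × I → ℤ, (∀ i, |p i - q i| ≤ 1) →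
          antipodal N (root p) = true → (∀ i, root p i = - root q i) → False := by
        intro p q hpq hp' hr
        obtain ⟨⟨i, hi⟩, -⟩ := antipodal_iff.1 hp'
        have h2 := hpq (.inl i)
        have h3 : p (.inl i) = - q (.inl i) := hr i
        have h4 : |p (.inl i)| = N := hi
        rw [abs_le] at h2
        rcases abs_cases (p (.inl i)) with h5 | h5 <;> omega
      rw [root_nodeCl, root_nodeCl] at h1
      rcases hsp : antipodal N (root p) with _ | _ <;>
        rcases hsq : antipodal N (root q) with _ | _ <;> rw [hsp, hsq] at hs <;>
        try exact hs rfl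
      · refine key q p (fun i => by rw [abs_sub_comm]; exact hpq i) hsq fun i => ?_
        have := congrFun h1 i
        simp [hsp, hsq, boolSign] at this
        omega
      · refine key p q hpq hsp fun i => ?_
        have := congrFun h1 i
        simp [hsp, hsq, boolSign] at this
        omega
    refine ext_tree ?_ fun b => ?_
    · have h1 := congrArg root h
      rw [root_nodeCl, root_nodeCl, hs] at h1
      ext i
      have h2 := congrFun h1 i
      rcases hsq : antipodal N (root q) with _ | _ <;> simpa [hsq, boolSign] using h2
    · refine C.cl_inj _ _ (fun i => hp _) (fun i => hq _) (fun i => hpq _) ?_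
      have h1 := congrArg (fun f => sub f (xor b (antipodal N (root q)))) h
      simp only [sub_nodeCl, hs] at h1
      simpa using h1

/-- The flip classes of the empty set of coordinates. -/
noncomputable def empty (N : ℤ) : FlipClasses FlipFamily.empty N where
  cl := id
  A _ := ContinuousLinearMap.id ℝ _
  surj _ := Function.surjective_id
  cl_flip _ a := a.elim
  A_flip _ a := a.elim
  cl_inj _ _ _ _ _ h := h

theorem exists_small_of_continuous (C : ∀ N : ℤ, 1 ≤ N → FlipClasses F N)
    {G : (I → ℝ) → (I → ℝ)} (hG : Continuous G)
    (hflip : ∀ x a, (∀ i, |x i| ≤ 1) → |x a| = 1 → G (F.flipR a x) = F.flipR a (G x))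
    {δ : ℝ} (hδ : 0 < δ) : ∃ x, (∀ i, |x i| ≤ 1) ∧ ‖G x‖ ≤ δ := by
  have huc := (isCompact_closedBall (0 : I → ℝ) 1).uniformContinuousOn_of_continuous
    hG.continuousOn
  obtain ⟨ρ, hρ, huc⟩ := Metric.uniformContinuousOn_iff.1 huc (δ / 2) (by positivity)
  obtain ⟨n, hn⟩ := exists_nat_gt (1 / ρ)
  set N : ℤ := 2 * (n + 2) with hNdef
  have hNR : (N : ℝ) = 2 * (n + 2) := by rw [hNdef]; push_cast; ring
  have hNpos : (0 : ℝ) < N := by rw [hNR]; positivity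
  set sc : (I → ℤ) → (I → ℝ) := fun p i => (p i : ℝ) / N with hsc
  have hsc1 : ∀ p : I → ℤ, (∀ i, |p i| ≤ N) → ∀ i, |sc p i| ≤ 1 := by
    intro p hp i
    rw [hsc]
    simp only
    rw [abs_div, abs_of_pos hNpos, div_le_one hNpos]
    exact_mod_cast hp i
  have hball : ∀ p : I → ℤ, (∀ i, |p i| ≤ N) → sc p ∈ Metric.closedBall (0 : I → ℝ) 1 := by
    intro p hp
    rw [mem_closedBall_zero_iff, pi_norm_le_iff_of_nonneg zero_le_one]
    exact hsc1 p hp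
  obtain ⟨p, hp, hle⟩ := (C N (by omega)).exists_small (by rw [hNdef]; exact even_two_mul _)
    (by omega) (fun p => G (sc p)) (fun p a hp ha => by
      have h1 : sc (F.flipZ a p) = F.flipR a (sc p) := by
        ext i
        simp only [hsc, F.flipR_apply, FlipFamily.flipZ]
        push_cast
        ring
      rw [h1]
      refine hflip _ _ (hsc1 p hp) ?_
      rw [hsc]
      rw [abs_div, abs_of_pos hNpos, div_eq_one_iff_eq hNpos.ne']
      exact_mod_cast ha) (by positivity : 0 < δ / 2) (fun p q hp hq hpq => by
      rw [← dist_eq_norm]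
      refine (huc _ (hball p hp) _ (hball q hq) ?_).le
      rw [dist_pi_lt_iff hρ]
      intro i
      rw [hsc]
      simp only
      rw [Real.dist_eq, ← sub_div, abs_div, abs_of_pos hNpos, div_lt_iff₀ hNpos]
      have h2 : |(p i : ℝ) - q i| ≤ 1 := by exact_mod_cast hpq i
      have h3 : 1 < ρ * n := by rwa [div_lt_iff₀' hρ] at hn
      rw [hNR]
      nlinarith)
  exact ⟨sc p, hsc1 p hp, hle.trans_eq (by ring)⟩

end FlipClasses

/-- `Branching step m k s l` says that `l` lists the states reached from `s` at times `k, …, k + m`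
along a binary tree, where at every node the two moves are made in opposite unit directions. -/
inductive Branching {S W : Type*} [NormedAddCommGroup W] (step : ℕ → S → W → S) :
    ℕ → ℕ → S → List S → Prop
  | leaf (k : ℕ) (s : S) : Branching step 0 k s [s]
  | node (m k : ℕ) (s : S) (u : W) (l r : List S) : ‖u‖ = 1 →
      Branching step m (k + 1) (step k s u) l → Branching step m (k + 1) (step k s (-u)) r →
      Branching step (m + 1) k s (l ++ r)

/-- Coordinates of configurations on the binary tree of depth `m`. -/
def TreeIdx (K : ℕ) : ℕ → Type
  | 0 => Empty
  | m + 1 => Fin K ⊕ Bool × TreeIdx K m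

namespace TreeIdx

variable {K : ℕ}

noncomputable instance instFintype (K : ℕ) : (m : ℕ) → Fintype (TreeIdx K m)
  | 0 => inferInstanceAs (Fintype Empty)
  | m + 1 =>
    have := instFintype K m
    inferInstanceAs (Fintype (Fin K ⊕ Bool × TreeIdx K m))

/-- The flip family of the binary tree of depth `m`. -/
def flips : (m : ℕ) → FlipFamily (TreeIdx K m)
  | 0 => FlipFamily.empty
  | m + 1 => (flips m).node K

/-- The flip classes of the binary tree of depth `m`. -/
noncomputable def classes {N : ℤ} (hN : 1 ≤ N) : (m : ℕ) → FlipClasses (flips (K := K) m) N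
  | 0 => FlipClasses.empty N
  | m + 1 => (classes hN m).node K hN

/-- The coordinates at the root. -/
def root {m : ℕ} (x : TreeIdx K (m + 1) → ℝ) : Fin K → ℝ := FlipClasses.root x

/-- The coordinates in a subtree. -/
def sub {m : ℕ} (x : TreeIdx K (m + 1) → ℝ) (b : Bool) : TreeIdx K m → ℝ := FlipClasses.sub x b

theorem continuous_root {m : ℕ} : Continuous (root : (TreeIdx K (m + 1) → ℝ) → _) :=
  continuous_pi fun i => continuous_apply (Sum.inl i : Fin K ⊕ Bool × TreeIdx K m)

theorem continuous_sub {m : ℕ} (b : Bool) :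
    Continuous fun x : TreeIdx K (m + 1) → ℝ => sub x b :=
  continuous_pi fun i => continuous_apply (Sum.inr (b, i) : Fin K ⊕ Bool × TreeIdx K m)

theorem ext_tree {m : ℕ} {x y : TreeIdx K (m + 1) → ℝ} (h : root x = root y)
    (h' : ∀ b, sub x b = sub y b) : x = y := FlipClasses.ext_tree h h'

variable {S W : Type*} [NormedAddCommGroup W] (step : ℕ → S → W → S) (Φ : S → Fin K → ℝ)
  (β : (Fin K → ℝ) → W)

/-- The direction chosen at the root, for the left and for the right subtree. -/
def dir {m : ℕ} (x : TreeIdx K (m + 1) → ℝ) (b : Bool) : W :=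
  if b then -β (root x) else β (root x)

/-- The average of `Φ` over the leaves of the tree encoded by `x`. -/
noncomputable def avg : (m k : ℕ) → S → (TreeIdx K m → ℝ) → Fin K → ℝ
  | 0, _, s, _ => Φ s
  | m + 1, k, s, x =>
    (1 / 2 : ℝ) • (avg m (k + 1) (step k s (dir β x false)) (sub x false) +
      avg m (k + 1) (step k s (dir β x true)) (sub x true))

/-- The differences of averages of `Φ` over pairs of sibling subtrees. -/
noncomputable def diff : (m k : ℕ) → S → (TreeIdx K m → ℝ) → TreeIdx K m → ℝ
  | 0, _, _, x => x
  | m + 1, k, s, x => Sum.elim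
      (avg step Φ β m (k + 1) (step k s (dir β x false)) (sub x false) -
        avg step Φ β m (k + 1) (step k s (dir β x true)) (sub x true))
      (fun i => diff m (k + 1) (step k s (dir β x i.1)) (sub x i.1) i.2)

theorem root_diff {m k : ℕ} (s : S) (x : TreeIdx K (m + 1) → ℝ) :
    root (diff step Φ β (m + 1) k s x) =
      avg step Φ β m (k + 1) (step k s (dir β x false)) (sub x false) -
        avg step Φ β m (k + 1) (step k s (dir β x true)) (sub x true) := rfl

theorem sub_diff {m k : ℕ} (s : S) (x : TreeIdx K (m + 1) → ℝ) (b : Bool) :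
    sub (diff step Φ β (m + 1) k s x) b =
      diff step Φ β m (k + 1) (step k s (dir β x b)) (sub x b) := rfl

variable {step Φ β}

theorem exists_branching (hβ1 : ∀ x, ‖β x‖ = 1) {δ : ℝ} (hδ : 0 ≤ δ) : ∀ (m k : ℕ) (s : S)
    (x : TreeIdx K m → ℝ), (∀ i, |diff step Φ β m k s x i| ≤ δ) →
    ∃ l, Branching step m k s l ∧ ∀ z ∈ l, ‖Φ z - avg step Φ β m k s x‖ ≤ m * δ
  | 0, k, s, x, _ => ⟨[s], .leaf k s, by simp [avg]⟩
  | m + 1, k, s, x, h => by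
    obtain ⟨l, hl, hl'⟩ := exists_branching hβ1 hδ m (k + 1)
      (step k s (dir β x false)) (sub x false)
      (fun i => h (Sum.inr (false, i) : Fin K ⊕ Bool × TreeIdx K m))
    obtain ⟨r, hr, hr'⟩ := exists_branching hβ1 hδ m (k + 1) (step k s (dir β x true)) (sub x true)
      (fun i => h (Sum.inr (true, i) : Fin K ⊕ Bool × TreeIdx K m))
    refine ⟨l ++ r, .node m k s (β (root x)) l r (hβ1 _) hl hr, fun z hz => ?_⟩
    set a := avg step Φ β m (k + 1) (step k s (dir β x false)) (sub x false)
    set a' := avg step Φ β m (k + 1) (step k s (dir β x true)) (sub x true)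
    have hroot : ∀ i, |(a - a') i| ≤ δ := fun i =>
      h (Sum.inl i : Fin K ⊕ Bool × TreeIdx K m)
    have hav : avg step Φ β (m + 1) k s x = (1 / 2 : ℝ) • (a + a') := rfl
    rw [List.mem_append] at hz
    have haa : ‖a - a'‖ ≤ δ := (pi_norm_le_iff_of_nonneg hδ).2 hroot
    have key : ∀ v w : Fin K → ℝ, ‖v - w‖ ≤ δ → ‖v - (1 / 2 : ℝ) • (v + w)‖ ≤ δ := by
      intro v w hvw
      have : v - (1 / 2 : ℝ) • (v + w) = (1 / 2 : ℝ) • (v - w) := by module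
      rw [this, norm_smul, Real.norm_of_nonneg (by norm_num)]
      linarith [norm_nonneg (v - w)]
    rw [hav]
    push_cast
    rcases hz with hz | hz
    · have h1 := hl' z hz
      have h2 := norm_sub_le_norm_sub_add_norm_sub (Φ z) a ((1 / 2 : ℝ) • (a + a'))
      linarith [key a a' haa]
    · have h1 := hr' z hz
      have h2 := norm_sub_le_norm_sub_add_norm_sub (Φ z) a' ((1 / 2 : ℝ) • (a + a'))
      have h3 := key a' a (by rwa [norm_sub_rev])
      rw [add_comm a' a] at h3
      linarith

theorem norm_root_eq {m : ℕ} (x : TreeIdx K (m + 1) → ℝ) (hx : ∀ i, |x i| ≤ 1) (a : Fin K)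
    (ha : |x (Sum.inl a : Fin K ⊕ Bool × TreeIdx K m)| = 1) : ‖root x‖ = 1 :=
  le_antisymm ((pi_norm_le_iff_of_nonneg zero_le_one).2 fun _ => hx _)
    (ha.symm.le.trans (norm_le_pi_norm (root x) a))

theorem dir_flip_inl {m : ℕ} (x : TreeIdx K (m + 1) → ℝ) (hx : β (-root x) = -β (root x))
    (a : Fin K) (b : Bool) :
    dir β ((flips (m + 1)).flipR (Sum.inl a : Fin K ⊕ Bool × TreeIdx K m) x) b =
      dir β x (!b) := by
  have : root ((flips (m + 1)).flipR (Sum.inl a : Fin K ⊕ Bool × TreeIdx K m) x) = -root x :=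
    FlipClasses.rootR_flip_inl _ _
  rw [dir, dir, this, hx]
  cases b <;> simp

theorem dir_flip_inr {m : ℕ} (x : TreeIdx K (m + 1) → ℝ) (a : Bool × TreeIdx K m) (b : Bool) :
    dir β ((flips (m + 1)).flipR (Sum.inr a : Fin K ⊕ Bool × TreeIdx K m) x) b = dir β x b := by
  have : root ((flips (m + 1)).flipR (Sum.inr a : Fin K ⊕ Bool × TreeIdx K m) x) = root x :=
    FlipClasses.rootR_flip_inr _ _
  rw [dir, dir, this]

theorem sub_flip_inl {m : ℕ} (x : TreeIdx K (m + 1) → ℝ) (a : Fin K) (b : Bool) :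
    sub ((flips (m + 1)).flipR (Sum.inl a : Fin K ⊕ Bool × TreeIdx K m) x) b = sub x (!b) :=
  FlipClasses.subR_flip_inl _ _ _

theorem sub_flip_inr {m : ℕ} (x : TreeIdx K (m + 1) → ℝ) (a : Bool × TreeIdx K m) (b : Bool) :
    sub ((flips (m + 1)).flipR (Sum.inr a : Fin K ⊕ Bool × TreeIdx K m) x) b =
      if b = a.1 then (flips m).flipR a.2 (sub x b) else sub x b :=
  FlipClasses.subR_flip_inr _ _ _

theorem avg_flip (hβ : ∀ x, ‖x‖ = 1 → β (-x) = -β x) : ∀ (m k : ℕ) (s : S)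
    (x : TreeIdx K m → ℝ) (a : TreeIdx K m), (∀ i, |x i| ≤ 1) → |x a| = 1 →
    avg step Φ β m k s ((flips m).flipR a x) = avg step Φ β m k s x
  | 0, _, _, _, a, _, _ => a.elim
  | m + 1, k, s, x, .inl a, hx, ha => by
    have h : β (-root x) = -β (root x) := hβ _ (norm_root_eq x hx a ha)
    simp only [avg, sub_flip_inl, dir_flip_inl x h]
    rw [add_comm]
    rfl
  | m + 1, k, s, x, .inr a, hx, ha => by
    simp only [avg, sub_flip_inr, dir_flip_inr]
    have h := fun k s => avg_flip hβ m k s (sub x a.1) a.2 (fun i => hx _) ha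
    obtain ⟨b, a⟩ := a
    cases b <;> simp_all

theorem diff_flip (hβ : ∀ x, ‖x‖ = 1 → β (-x) = -β x) : ∀ (m k : ℕ) (s : S)
    (x : TreeIdx K m → ℝ) (a : TreeIdx K m), (∀ i, |x i| ≤ 1) → |x a| = 1 →
    diff step Φ β m k s ((flips m).flipR a x) = (flips m).flipR a (diff step Φ β m k s x)
  | 0, _, _, _, a, _, _ => a.elim
  | m + 1, k, s, x, .inl a, hx, ha => by
    have h : β (-root x) = -β (root x) := hβ _ (norm_root_eq x hx a ha)
    refine ext_tree ?_ fun b => ?_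
    · refine Eq.trans ?_ (FlipClasses.rootR_flip_inl _ _).symm
      refine Eq.trans ?_ (congrArg Neg.neg (root_diff step Φ β s x).symm)
      rw [root_diff]
      simp only [sub_flip_inl, dir_flip_inl x h, neg_sub]
      rfl
    · rw [sub_flip_inl, sub_diff, sub_diff, sub_flip_inl, dir_flip_inl x h]
  | m + 1, k, s, x, .inr a, hx, ha => by
    have h := fun k s => avg_flip (step := step) (Φ := Φ) hβ m k s (sub x a.1) a.2
      (fun i => hx _) ha
    have h' := fun k s => diff_flip hβ m k s (sub x a.1) a.2 (fun i => hx _) ha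
    refine ext_tree ?_ fun b => ?_
    · refine Eq.trans ?_ (FlipClasses.rootR_flip_inr _ _).symm
      refine Eq.trans ?_ (root_diff step Φ β s x).symm
      rw [root_diff]
      simp only [sub_flip_inr, dir_flip_inr]
      obtain ⟨b, a⟩ := a
      cases b <;> simp_all
    · rw [sub_flip_inr, sub_diff, sub_diff, sub_flip_inr, dir_flip_inr]
      split_ifs with hb
      · subst hb
        exact h' _ _
      · rfl

section Continuity

variable [TopologicalSpace S]

theorem continuous_dir (hβ : Continuous β) {m : ℕ} (b : Bool) :
    Continuous fun x : TreeIdx K (m + 1) → ℝ => dir β x b := by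
  cases b
  · exact hβ.comp continuous_root
  · exact (hβ.comp continuous_root).neg

theorem continuous_child (hstep : ∀ k, Continuous fun q : S × W => step k q.1 q.2)
    (hβ : Continuous β) {m : ℕ} (k : ℕ) (b : Bool) :
    Continuous fun q : S × (TreeIdx K (m + 1) → ℝ) => (step k q.1 (dir β q.2 b), sub q.2 b) :=
  ((hstep k).comp (continuous_fst.prodMk ((continuous_dir hβ b).comp continuous_snd))).prodMk
    ((continuous_sub b).comp continuous_snd)

theorem continuous_avg (hstep : ∀ k, Continuous fun q : S × W => step k q.1 q.2)
    (hΦ : Continuous Φ) (hβ : Continuous β) : ∀ m k : ℕ,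
    Continuous fun q : S × (TreeIdx K m → ℝ) => avg step Φ β m k q.1 q.2
  | 0, _ => hΦ.comp continuous_fst
  | m + 1, k => by
    simp only [avg]
    exact (((continuous_avg hstep hΦ hβ m (k + 1)).comp
      (continuous_child hstep hβ k false)).add ((continuous_avg hstep hΦ hβ m (k + 1)).comp
      (continuous_child hstep hβ k true))).const_smul (1 / 2 : ℝ)

theorem continuous_diff (hstep : ∀ k, Continuous fun q : S × W => step k q.1 q.2)
    (hΦ : Continuous Φ) (hβ : Continuous β) : ∀ m k : ℕ,
    Continuous fun q : S × (TreeIdx K m → ℝ) => diff step Φ β m k q.1 q.2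
  | 0, _ => continuous_snd
  | m + 1, k => by
    refine continuous_pi fun i => ?_
    rcases i with i | ⟨b, i⟩
    · exact (continuous_apply i).comp (((continuous_avg hstep hΦ hβ m (k + 1)).comp
        (continuous_child hstep hβ k false)).sub ((continuous_avg hstep hΦ hβ m (k + 1)).comp
        (continuous_child hstep hβ k true)))
    · exact (continuous_apply i).comp ((continuous_diff hstep hΦ hβ m (k + 1)).comp
        (continuous_child hstep hβ k b))

end Continuity

end TreeIdx

/-- A map to the sphere which is odd on the boundary of the cube, up to normalization. -/
noncomputable def sphereLift {K : ℕ} (x : Fin K → ℝ) : EuclideanSpace ℝ (Fin (K + 1)) :=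
  WithLp.toLp 2 (Fin.cons (max 0 (1 - ‖x‖)) x)

theorem sphereLift_ne_zero {K : ℕ} (x : Fin K → ℝ) : sphereLift x ≠ 0 := by
  intro h
  have hx : x = 0 := by
    ext i
    have := congrArg (fun v : EuclideanSpace ℝ (Fin (K + 1)) => v i.succ) h
    simpa [sphereLift] using this
  have := congrArg (fun v : EuclideanSpace ℝ (Fin (K + 1)) => v 0) h
  simp [sphereLift, hx] at this

theorem continuous_sphereLift {K : ℕ} : Continuous (sphereLift : (Fin K → ℝ) → _) := by
  refine (PiLp.continuous_toLp 2 _).comp (continuous_pi fun i => ?_)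
  refine Fin.cases ?_ (fun i => ?_) i
  · simp only [Fin.cons_zero]
    fun_prop
  · simp only [Fin.cons_succ]
    fun_prop

/-- A map to the sphere which is odd on the boundary of the cube. -/
noncomputable def sphereMap {K : ℕ} (x : Fin K → ℝ) : EuclideanSpace ℝ (Fin (K + 1)) :=
  ‖sphereLift x‖⁻¹ • sphereLift x

theorem norm_sphereMap {K : ℕ} (x : Fin K → ℝ) : ‖sphereMap x‖ = 1 := by
  rw [sphereMap, norm_smul, norm_inv, norm_norm,
    inv_mul_cancel₀ (norm_ne_zero_iff.2 (sphereLift_ne_zero x))]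

theorem continuous_sphereMap {K : ℕ} : Continuous (sphereMap : (Fin K → ℝ) → _) :=
  (continuous_sphereLift.norm.inv₀ fun x => norm_ne_zero_iff.2 (sphereLift_ne_zero x)).smul
    continuous_sphereLift

theorem sphereMap_neg {K : ℕ} {x : Fin K → ℝ} (hx : ‖x‖ = 1) : sphereMap (-x) = -sphereMap x := by
  have : sphereLift (-x) = -sphereLift x := by
    ext i
    refine Fin.cases ?_ (fun i => ?_) i <;> simp [sphereLift, hx]
  rw [sphereMap, sphereMap, this, norm_neg, smul_neg]

/-- A tree version of the Borsuk–Ulam theorem: along suitable branching directions all leaves have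
nearly the same image. -/
theorem exists_branching_close {K : ℕ} {S : Type*} [TopologicalSpace S]
    {step : ℕ → S → EuclideanSpace ℝ (Fin (K + 1)) → S}
    (hstep : ∀ k, Continuous fun q : S × EuclideanSpace ℝ (Fin (K + 1)) => step k q.1 q.2)
    {Φ : S → Fin K → ℝ} (hΦ : Continuous Φ) (m : ℕ) (s : S) {η : ℝ} (hη : 0 < η) :
    ∃ (l : List S) (y : Fin K → ℝ), Branching step m 0 s l ∧ ∀ z ∈ l, ‖Φ z - y‖ ≤ η := by
  obtain ⟨x, -, hx⟩ := FlipClasses.exists_small_of_continuous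
    (fun N hN => TreeIdx.classes (K := K) (N := N) hN m)
    ((TreeIdx.continuous_diff hstep hΦ continuous_sphereMap m 0).comp
      (Continuous.prodMk_right s))
    (fun x a h1 h2 => TreeIdx.diff_flip (fun _ => sphereMap_neg) m 0 s x a h1 h2)
    (div_pos hη (by positivity : (0 : ℝ) < m + 1))
  obtain ⟨l, hl, hl'⟩ := TreeIdx.exists_branching norm_sphereMap (by positivity) m 0 s x
    fun i => (norm_le_pi_norm _ i).trans hx
  refine ⟨l, _, hl, fun z hz => (hl' z hz).trans ?_⟩
  rw [← mul_div_assoc, div_le_iff₀ (by positivity)]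
  nlinarith

namespace Gauss

open scoped InnerProductSpace

/-- The `i`-th standard basis vector, and `0` out of range. -/
noncomputable def stdVec (M i : ℕ) : EuclideanSpace ℝ (Fin M) :=
  if h : i < M then EuclideanSpace.single ⟨i, h⟩ 1 else 0

/-- The combination of the vectors `v i` with coefficients `u i`. -/
noncomputable def comb {n M : ℕ} (v : Fin n → EuclideanSpace ℝ (Fin M))
    (u : EuclideanSpace ℝ (Fin n)) : EuclideanSpace ℝ (Fin M) := ∑ i, u i • v i

/-- The frame obtained from `v` by moving the direction `u` to the vector `e`. -/
noncomputable def turn {n M : ℕ} (v : Fin n → EuclideanSpace ℝ (Fin M))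
    (e : EuclideanSpace ℝ (Fin M)) (u : EuclideanSpace ℝ (Fin n)) :
    Fin n → EuclideanSpace ℝ (Fin M) := fun i => v i + u i • (e - comb v u)

/-- A position together with a frame of `K + 1` vectors in dimension `K + d`. -/
abbrev State (K d : ℕ) :=
  EuclideanSpace ℝ (Fin (K + d)) × (Fin (K + 1) → EuclideanSpace ℝ (Fin (K + d)))

/-- At the start of a round, the position is scaled by `κ` and the frame is reset. -/
noncomputable def reset {K d : ℕ} (κ : ℝ) (k : ℕ) (s : State K d) : State K d :=
  if k % d = 0 then (κ • s.1, fun i => stdVec _ i) else s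

/-- One move of the walk: a step in the direction of the frame given by `u`, after which this
direction is replaced by a fresh coordinate direction. -/
noncomputable def move {K d : ℕ} (κ : ℝ) (k : ℕ) (s : State K d)
    (u : EuclideanSpace ℝ (Fin (K + 1))) : State K d :=
  ((reset κ k s).1 + comb (reset κ k s).2 u,
    turn (reset κ k s).2 (stdVec _ (K + 1 + k % d)) u)

theorem continuous_move {K d : ℕ} (κ : ℝ) (k : ℕ) :
    Continuous fun q : State K d × EuclideanSpace ℝ (Fin (K + 1)) => move κ k q.1 q.2 := by
  unfold move reset
  split_ifs <;> unfold turn comb <;> fun_prop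

/-- The frame `v` is orthonormal, orthogonal to `D`, and everything lives in the first
`K + 1 + j` coordinates. -/
structure Frame {n M : ℕ} (j : ℕ) (v : Fin n → EuclideanSpace ℝ (Fin M))
    (D : EuclideanSpace ℝ (Fin M)) : Prop where
  on : Orthonormal ℝ v
  orth : ∀ i, ⟪v i, D⟫_ℝ = 0
  supp : ∀ i (a : Fin M), n + j ≤ a → v i a = 0
  supp' : ∀ a : Fin M, n + j ≤ a → D a = 0

theorem inner_comb {n M : ℕ} (v : Fin n → EuclideanSpace ℝ (Fin M))
    (u : EuclideanSpace ℝ (Fin n)) (x : EuclideanSpace ℝ (Fin M)) :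
    ⟪x, comb v u⟫_ℝ = ∑ i, u i * ⟪x, v i⟫_ℝ := by
  simp [comb, inner_sum, inner_smul_right]

theorem inner_comb_self {n M : ℕ} {v : Fin n → EuclideanSpace ℝ (Fin M)} (hv : Orthonormal ℝ v)
    (u : EuclideanSpace ℝ (Fin n)) (i : Fin n) : ⟪v i, comb v u⟫_ℝ = u i := by
  rw [inner_comb]
  simp [orthonormal_iff_ite.1 hv]

theorem norm_comb {n M : ℕ} {v : Fin n → EuclideanSpace ℝ (Fin M)} (hv : Orthonormal ℝ v)
    {u : EuclideanSpace ℝ (Fin n)} (hu : ‖u‖ = 1) : ⟪comb v u, comb v u⟫_ℝ = 1 := by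
  rw [inner_comb]
  simp only [real_inner_comm, inner_comb_self hv]
  have := EuclideanSpace.real_norm_sq_eq u
  rw [hu] at this
  simp only [← pow_two, ← this]
  norm_num

theorem Frame.turn {n M j : ℕ} {v : Fin n → EuclideanSpace ℝ (Fin M)}
    {D : EuclideanSpace ℝ (Fin M)} (h : Frame j v D) (hj : n + j < M)
    {u : EuclideanSpace ℝ (Fin n)} (hu : ‖u‖ = 1) (r : ℝ) :
    Frame (j + 1) (turn v (stdVec M (n + j)) u) (D + r • comb v u) := by
  have hb := norm_comb h.on hu
  have hvb := inner_comb_self h.on u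
  set b := comb v u with hbdef
  set e := stdVec M (n + j) with he
  have he' : e = EuclideanSpace.single ⟨n + j, hj⟩ 1 := by simp [he, stdVec, hj]
  have hve : ∀ i, ⟪v i, e⟫_ℝ = 0 := by
    intro i
    rw [he']
    simp [EuclideanSpace.inner_single_right, h.supp i ⟨n + j, hj⟩ le_rfl]
  have hDe : ⟪e, D⟫_ℝ = 0 := by
    rw [he']
    simp [EuclideanSpace.inner_single_left, h.supp' ⟨n + j, hj⟩ le_rfl]
  have hbe : ⟪e, b⟫_ℝ = 0 := by
    rw [hbdef, inner_comb]
    simp [real_inner_comm, hve]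
  have hee : ⟪e, e⟫_ℝ = 1 := by
    rw [he']; simp
  have hbD : ⟪b, D⟫_ℝ = 0 := by
    rw [real_inner_comm, hbdef, inner_comb]
    exact Finset.sum_eq_zero fun i _ => by rw [real_inner_comm, h.orth, mul_zero]
  have hcoord : ∀ a : Fin M, n + (j + 1) ≤ a → e a = 0 := by
    intro a ha
    rw [he']
    have : a ≠ ⟨n + j, hj⟩ := by
      rintro rfl
      simp at ha
    simp [this]
  have hbc : ∀ a : Fin M, n + (j + 1) ≤ a → b a = 0 := by
    intro a ha
    rw [hbdef, comb]
    simp [h.supp _ a (by omega)]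
  refine ⟨?_, fun i => ?_, fun i a ha => ?_, fun a ha => ?_⟩
  · rw [orthonormal_iff_ite]
    intro i i'
    have h1 := orthonormal_iff_ite.1 h.on i i'
    simp only [Gauss.turn, ← hbdef, inner_add_left, inner_add_right, inner_sub_left,
      inner_sub_right, inner_smul_left, inner_smul_right, hve, hvb, hb, hee, hbe,
      real_inner_comm (v i') e,
      real_inner_comm (v i') b, real_inner_comm e b, h1]
    simp
    ring
  · simp only [Gauss.turn, ← hbdef, inner_add_left, inner_add_right, inner_sub_left,
      inner_smul_left, inner_smul_right, hvb, hb, hbe, hDe, hbD, h.orth]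
    simp
  · simp [Gauss.turn, ← hbdef, h.supp i a (by omega), hcoord a ha, hbc a ha]
  · simp [h.supp' a (by omega), hbc a ha]

theorem frame_stdVec {K d : ℕ} (hd : 0 < d) :
    Frame 0 (fun i : Fin (K + 1) => stdVec (K + d) i) 0 := by
  have h : ∀ i : Fin (K + 1), stdVec (K + d) i =
      EuclideanSpace.single (⟨i, by omega⟩ : Fin (K + d)) 1 := by
    intro i
    simp [stdVec, show (i : ℕ) < K + d by omega]
  refine ⟨?_, fun i => inner_zero_right _, fun i a ha => ?_, fun a _ => rfl⟩
  · rw [orthonormal_iff_ite]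
    intro i i'
    rw [h, h]
    simp [EuclideanSpace.inner_single_left, Fin.ext_iff]
  · rw [h]
    have : a ≠ ⟨i, by omega⟩ := fun h => by
      have : (a : ℕ) = i := congrArg Fin.val h
      omega
    simp [this]

/-- The potential of a displacement `Y` from the centre, given its orthogonal part `Z`. -/
noncomputable def energy {M : ℕ} (t : ℝ) (Y Z : EuclideanSpace ℝ (Fin M)) : ℝ :=
  Real.exp (-‖Y‖ ^ 2 / (2 * t) + ‖Z‖ ^ 2 / (2 * t ^ 2))

theorem energy_step {M : ℕ} {t : ℝ} (ht : 0 < t) {Y Z b : EuclideanSpace ℝ (Fin M)}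
    (hb : ⟪b, b⟫_ℝ = 1) (hYZ : ⟪b, Y - Z⟫_ℝ = 0) :
    energy t (Y + b) (Z - ⟪Z, b⟫_ℝ • b) + energy t (Y - b) (Z - ⟪Z, b⟫_ℝ • b) ≤
      2 * Real.exp (-1 / (2 * t)) * energy t Y Z := by
  set β := ⟪Z, b⟫_ℝ with hβ
  have hYb : ⟪Y, b⟫_ℝ = β := by
    rw [inner_sub_right, real_inner_comm, real_inner_comm Z b] at hYZ
    linarith
  have hb' : ‖b‖ ^ 2 = 1 := by rw [← real_inner_self_eq_norm_sq, hb]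
  have h1 : ‖Y + b‖ ^ 2 = ‖Y‖ ^ 2 + 2 * β + 1 := by
    rw [norm_add_sq_real, hYb, hb']
  have h2 : ‖Y - b‖ ^ 2 = ‖Y‖ ^ 2 - 2 * β + 1 := by
    rw [norm_sub_sq_real, hYb, hb']
  have h3 : ‖Z - β • b‖ ^ 2 = ‖Z‖ ^ 2 - β ^ 2 := by
    rw [norm_sub_sq_real, inner_smul_right, ← hβ, norm_smul, mul_pow, hb', Real.norm_eq_abs, sq_abs]
    ring
  have h4 := Real.cosh_le_exp_half_sq (β / t)
  rw [Real.cosh_eq] at h4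
  set A := Real.exp (-1 / (2 * t)) * energy t Y Z * Real.exp (-(β / t) ^ 2 / 2) with hA
  have hA0 : 0 ≤ A := by unfold A energy; positivity
  have h5 : energy t (Y + b) (Z - β • b) = A * Real.exp (-(β / t)) := by
    rw [hA, energy, energy, h1, h3, ← Real.exp_add, ← Real.exp_add, ← Real.exp_add]
    congr 1
    field_simp
    ring
  have h6 : energy t (Y - b) (Z - β • b) = A * Real.exp (β / t) := by
    rw [hA, energy, energy, h2, h3, ← Real.exp_add, ← Real.exp_add, ← Real.exp_add]
    congr 1
    field_simp
    ring
  have h7 : A * Real.exp ((β / t) ^ 2 / 2) = Real.exp (-1 / (2 * t)) * energy t Y Z := by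
    rw [hA, mul_assoc, ← Real.exp_add]
    simp [neg_div]
  have h8 := mul_le_mul_of_nonneg_left h4 hA0
  have h9 : 2 * Real.exp (-1 / (2 * t)) * energy t Y Z =
      2 * (A * Real.exp ((β / t) ^ 2 / 2)) := by rw [h7]; ring
  rw [h5, h6, h9]
  linarith

/-- `B` is an admissible bound for the state `s` at time `k`, relative to the centre `c`. -/
def IsPot {K d : ℕ} (t : ℝ) (k : ℕ) (s : State K d) (c : EuclideanSpace ℝ (Fin (K + d)))
    (B : ℝ) : Prop :=
  if k % d = 0 then B = Real.exp (-‖s.1 - c‖ ^ 2 / (2 * t)) else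
    ∃ Z, Frame (k % d) s.2 (s.1 - c - Z) ∧ B = energy t (s.1 - c) Z

theorem IsPot.le {K d : ℕ} {t : ℝ} {k : ℕ} {s : State K d}
    {c : EuclideanSpace ℝ (Fin (K + d))} {B : ℝ} (h : IsPot t k s c B) :
    Real.exp (-‖s.1 - c‖ ^ 2 / (2 * t)) ≤ B := by
  unfold IsPot at h
  split_ifs at h
  · exact h.ge
  · obtain ⟨Z, -, rfl⟩ := h
    rw [energy, Real.exp_le_exp]
    exact le_add_of_nonneg_right (by positivity)

/-- The scaling of the centre at time `k`. -/
noncomputable def scale (κ : ℝ) (d k : ℕ) : ℝ := if k % d = 0 then κ else 1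

theorem IsPot.reset {K d : ℕ} (hd : 0 < d) {κ t : ℝ} (ht : t⁻¹ = 1 - (κ ^ 2)⁻¹) (hκ : κ ≠ 0)
    {k : ℕ} {s : State K d} {c : EuclideanSpace ℝ (Fin (K + d))} {B : ℝ} (h : IsPot t k s c B) :
    ∃ Z, Frame (k % d) (reset κ k s).2 ((reset κ k s).1 - scale κ d k • c - Z) ∧
      B = energy t ((reset κ k s).1 - scale κ d k • c) Z := by
  unfold IsPot at h
  unfold Gauss.reset scale
  split_ifs at h ⊢ with h0
  · refine ⟨κ • s.1 - κ • c, ?_, ?_⟩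
    · rw [h0, sub_self]
      exact frame_stdVec hd
    · rw [h, energy, ← smul_sub, norm_smul, mul_pow, Real.norm_eq_abs, sq_abs]
      congr 1
      have : κ ^ 2 * (1 - t⁻¹) = 1 := by rw [ht]; field_simp; ring
      rw [div_eq_mul_inv, div_eq_mul_inv, div_eq_mul_inv, mul_inv, mul_inv, ← inv_pow]
      linear_combination (-1 : ℝ) * (-‖s.1 - c‖ ^ 2 * (2⁻¹ * t⁻¹)) * this
  · simpa using h

theorem IsPot.move {K d : ℕ} (hd : 0 < d) {κ t : ℝ} (ht : t⁻¹ = 1 - (κ ^ 2)⁻¹) (hκ : κ ≠ 0)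
    (ht0 : 0 < t)
    {k : ℕ} {s : State K d} {c : EuclideanSpace ℝ (Fin (K + d))} {B : ℝ} (h : IsPot t k s c B)
    {u : EuclideanSpace ℝ (Fin (K + 1))} (hu : ‖u‖ = 1) :
    ∃ B₁ B₂, IsPot t (k + 1) (move κ k s u) (scale κ d k • c) B₁ ∧
      IsPot t (k + 1) (move κ k s (-u)) (scale κ d k • c) B₂ ∧
      B₁ + B₂ ≤ 2 * Real.exp (-1 / (2 * t)) * B := by
  obtain ⟨Z, hZ, rfl⟩ := h.reset hd ht hκ
  unfold Gauss.move
  set s' := Gauss.reset κ k s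
  set c' := scale κ d k • c
  set b := comb s'.2 u with hb
  have hnb : comb s'.2 (-u) = -b := by simp [hb, comb]
  have hbb := norm_comb hZ.on hu
  have hbD : ⟪b, s'.1 - c' - Z⟫_ℝ = 0 := by
    rw [real_inner_comm, hb, inner_comb]
    simp [real_inner_comm, hZ.orth]
  have hmod : (k + 1) % d ≠ 0 → (k + 1) % d = k % d + 1 ∧ K + 1 + k % d < K + d := by
    intro h0
    have h1 := Nat.mod_lt k hd
    rcases Nat.lt_or_ge (k % d + 1) d with h2 | h2
    · have : (k + 1) % d = k % d + 1 := by
        rw [Nat.add_mod]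
        rcases Nat.lt_or_ge 1 d with h3 | h3
        · rw [Nat.mod_eq_of_lt h3, Nat.mod_eq_of_lt h2]
        · omega
      omega
    · exfalso
      apply h0
      have h4 : k % d = d - 1 := by omega
      have h5 := Nat.div_add_mod k d
      rw [h4] at h5
      rw [show k + 1 = d * (k / d + 1) by rw [mul_add]; omega]
      exact Nat.mul_mod_right _ _
  have key : ∀ u' : EuclideanSpace ℝ (Fin (K + 1)), ‖u'‖ = 1 → ∀ r : ℝ,
      r • comb s'.2 u' = comb s'.2 u' + ⟪Z, b⟫_ℝ • b → ∃ B', IsPot t (k + 1) (s'.1 + comb s'.2 u',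
        turn s'.2 (stdVec _ (K + 1 + k % d)) u') c' B' ∧
        B' ≤ energy t (s'.1 - c' + comb s'.2 u') (Z - ⟪Z, b⟫_ℝ • b) := by
    intro u' hu' r hr
    unfold IsPot
    have e1 : s'.1 + comb s'.2 u' - c' = s'.1 - c' + comb s'.2 u' := by abel
    split_ifs with h0
    · refine ⟨_, rfl, ?_⟩
      rw [energy, Real.exp_le_exp]
      simp only [e1]
      exact le_add_of_nonneg_right (by positivity)
    · obtain ⟨h1, h2⟩ := hmod h0
      refine ⟨_, ⟨Z - ⟪Z, b⟫_ℝ • b, ?_, rfl⟩, by simp only [e1]; rfl⟩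
      rw [h1]
      convert hZ.turn h2 hu' r using 1
      simp only
      rw [hr]
      abel
  obtain ⟨B₁, h1, h1'⟩ := key u hu (1 + ⟪Z, b⟫_ℝ) (by rw [add_smul, one_smul])
  obtain ⟨B₂, h2, h2'⟩ := key (-u) (by rwa [norm_neg]) (1 - ⟪Z, b⟫_ℝ) (by
    rw [hnb, sub_smul, one_smul, smul_neg, sub_neg_eq_add])
  refine ⟨B₁, B₂, h1, h2, ?_⟩
  rw [hnb, ← sub_eq_add_neg] at h2'
  exact (add_le_add h1' h2').trans (energy_step ht0 hbb hbD)

theorem sum_exp_le {K d : ℕ} (hd : 0 < d) {κ t : ℝ} (ht : t⁻¹ = 1 - (κ ^ 2)⁻¹) (hκ : κ ≠ 0)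
    (ht0 : 0 < t) {m k : ℕ} {s : State K d} {l : List (State K d)}
    (hl : Branching (move κ) m k s l) : ∀ (c : EuclideanSpace ℝ (Fin (K + d))) (B : ℝ),
    IsPot t k s c B →
    (l.map fun z => Real.exp (-‖z.1 - (∏ i ∈ Finset.range m, scale κ d (k + i)) • c‖ ^ 2 /
      (2 * t))).sum ≤ (2 * Real.exp (-1 / (2 * t))) ^ m * B := by
  induction hl with
  | leaf k s =>
    intro c B h
    simpa using h.le
  | node m k s u l r hu _ _ ihl ihr =>
    intro c B h
    obtain ⟨B₁, B₂, h1, h2, h3⟩ := h.move hd ht hκ ht0 hu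
    have e : (∏ i ∈ Finset.range (m + 1), scale κ d (k + i)) • c =
        (∏ i ∈ Finset.range m, scale κ d (k + 1 + i)) • scale κ d k • c := by
      rw [Finset.prod_range_succ', smul_smul]
      simp only [add_zero, add_assoc, add_comm 1]
    have h4 := ihl _ _ h1
    have h5 := ihr _ _ h2
    rw [List.map_append, List.sum_append, e, pow_succ, mul_assoc]
    refine (add_le_add h4 h5).trans ?_
    rw [← mul_add]
    exact mul_le_mul_of_nonneg_left h3 (by positivity)

theorem prod_scale {κ : ℝ} {d : ℕ} (hd : 0 < d) (L : ℕ) :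
    ∏ i ∈ Finset.range (L * d), scale κ d (0 + i) = κ ^ L := by
  induction L with
  | zero => simp
  | succ L ih =>
    rw [add_mul, one_mul, Finset.prod_range_add, ih, pow_succ]
    congr 1
    rw [Finset.prod_eq_single 0]
    · simp [scale]
    · intro i hi hi0
      simp [scale, Nat.mod_eq_of_lt (Finset.mem_range.1 hi), hi0]
    · simp [hd.ne']

theorem _root_.Branching.length_eq {S W : Type*} [NormedAddCommGroup W] {step : ℕ → S → W → S}
    {m k : ℕ} {s : S} {l : List S} (h : Branching step m k s l) : l.length = 2 ^ m := by
  induction h with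
  | leaf => rfl
  | node m k s u l r _ _ _ h1 h2 => rw [List.length_append, h1, h2, pow_succ]; ring

/-- Gaussian averages along the walk started at the origin. -/
theorem sum_exp_le_of_zero {K d : ℕ} (hd : 0 < d) {κ t : ℝ} (ht : t⁻¹ = 1 - (κ ^ 2)⁻¹)
    (hκ : κ ≠ 0) (ht0 : 0 < t) {L : ℕ} {l : List (State K d)}
    (hl : Branching (move κ) (L * d) 0 0 l) (y : EuclideanSpace ℝ (Fin (K + d))) :
    (l.map fun z => Real.exp (-‖z.1 - κ ^ L • y‖ ^ 2 / (2 * t))).sum ≤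
      (2 * Real.exp (-1 / (2 * t))) ^ (L * d) * Real.exp (-‖y‖ ^ 2 / (2 * t)) := by
  have h := sum_exp_le hd ht hκ ht0 hl y (Real.exp (-‖y‖ ^ 2 / (2 * t))) (by simp [IsPot])
  rwa [prod_scale hd] at h

end Gauss

/-- The folding map of the line onto the unit interval. -/
noncomputable def fold (x : ℝ) : unitInterval :=
  ⟨Real.arccos (Real.cos (Real.pi * x)) / Real.pi,
    div_nonneg (Real.arccos_nonneg _) Real.pi_pos.le,
    (div_le_one Real.pi_pos).2 (Real.arccos_le_pi _)⟩

theorem continuous_fold : Continuous fold :=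
  Continuous.subtype_mk ((Real.continuous_arccos.comp
    (Real.continuous_cos.comp (continuous_const.mul continuous_id))).div_const _) _

theorem exists_eq_fold (x : ℝ) : ∃ q : ℤ × Bool, x = 2 * q.1 + boolSign q.2 * (fold x : ℝ) := by
  have h : Real.cos (Real.pi * (fold x : ℝ)) = Real.cos (Real.pi * x) := by
    simp only [fold]
    rw [mul_div_cancel₀ _ Real.pi_ne_zero, Real.cos_arccos (Real.neg_one_le_cos _)
      (Real.cos_le_one _)]
  obtain ⟨k, hk | hk⟩ := Real.cos_eq_cos_iff.1 h
  · refine ⟨(k, false), mul_left_cancel₀ Real.pi_ne_zero ?_⟩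
    simp only [boolSign, hk]
    push_cast
    ring_nf
  · refine ⟨(k, true), mul_left_cancel₀ Real.pi_ne_zero ?_⟩
    simp only [boolSign, hk]
    push_cast
    ring_nf

theorem sq_le_sq_unfold (q : ℤ × Bool) (α : unitInterval) :
    (q.1 : ℝ) ^ 2 ≤ (2 * q.1 + boolSign q.2 * (α : ℝ)) ^ 2 := by
  obtain ⟨k, s⟩ := q
  have h0 := α.2.1
  have h1 := α.2.2
  rw [sq_le_sq]
  have h2 : |(boolSign s : ℝ) * (α : ℝ)| ≤ 1 := by
    cases s <;> simp [boolSign, abs_of_nonneg h0, h1]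
  rcases eq_or_ne k 0 with rfl | hk
  · simp; positivity
  · have h3 : (1 : ℝ) ≤ |(k : ℝ)| := by exact_mod_cast Int.one_le_abs hk
    have h4 := abs_sub_abs_le_abs_sub (2 * (k : ℝ)) (-(boolSign s * (α : ℝ)))
    rw [sub_neg_eq_add, abs_neg, abs_mul, abs_two] at h4
    simp only
    linarith

theorem summable_exp_neg_sq {t : ℝ} (ht : 0 < t) :
    Summable fun k : ℤ => Real.exp (-(k : ℝ) ^ 2 / (2 * t)) := by
  have h : Summable fun n : ℕ => Real.exp (-(n : ℝ) ^ 2 / (2 * t)) := by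
    have hr : Real.exp (-1 / (2 * t)) < 1 := by
      rw [Real.exp_lt_one_iff]
      exact div_neg_of_neg_of_pos (by norm_num) (by positivity)
    refine Summable.of_nonneg_of_le (fun n => (Real.exp_pos _).le) (fun n => ?_)
      (summable_geometric_of_lt_one (Real.exp_pos _).le hr)
    rw [← Real.exp_nat_mul, Real.exp_le_exp, ← mul_div_assoc]
    gcongr
    have : (n : ℝ) ≤ (n : ℝ) ^ 2 := by exact_mod_cast Nat.le_self_pow two_ne_zero n
    linarith
  exact Summable.of_nat_of_neg (by simpa using h) (by simpa using h)

/-- A bound for the Gaussian sums over reflected lattices on the line. -/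
noncomputable def latticeSum (t : ℝ) : ℝ := 2 * ∑' k : ℤ, Real.exp (-(k : ℝ) ^ 2 / (2 * t))

theorem latticeSum_pos {t : ℝ} (ht : 0 < t) : 0 < latticeSum t :=
  mul_pos two_pos ((summable_exp_neg_sq ht).tsum_pos (fun _ => (Real.exp_pos _).le) 0
    (Real.exp_pos _))

theorem sum_exp_unfold_le {t : ℝ} (ht : 0 < t) (S : Finset ℤ) (α : unitInterval) :
    ∑ q ∈ S ×ˢ Finset.univ, Real.exp (-(2 * (q.1 : ℝ) + boolSign q.2 * (α : ℝ)) ^ 2 / (2 * t)) ≤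
      latticeSum t := by
  calc _ ≤ ∑ q ∈ S ×ˢ (Finset.univ : Finset Bool), Real.exp (-(q.1 : ℝ) ^ 2 / (2 * t)) := by
        refine Finset.sum_le_sum fun q _ => ?_
        have := sq_le_sq_unfold q α
        gcongr
    _ = 2 * ∑ k ∈ S, Real.exp (-(k : ℝ) ^ 2 / (2 * t)) := by
        rw [Finset.sum_product, Finset.mul_sum]
        simp
    _ ≤ latticeSum t := by
        rw [latticeSum]
        gcongr
        exact (summable_exp_neg_sq ht).sum_le_tsum _ fun _ _ => (Real.exp_pos _).le

/-- The point over `α` in the box of the reflected lattice given by `g`. -/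
noncomputable def unfold {M : ℕ} (α : Cube M) (g : Fin M → ℤ × Bool) :
    EuclideanSpace ℝ (Fin M) :=
  WithLp.toLp 2 fun i => 2 * ((g i).1 : ℝ) + boolSign (g i).2 * (α i : ℝ)

theorem sum_exp_norm_unfold_le {M : ℕ} {t : ℝ} (ht : 0 < t) (S : Finset ℤ) (α : Cube M) :
    ∑ g ∈ Fintype.piFinset fun _ : Fin M => S ×ˢ (Finset.univ : Finset Bool),
      Real.exp (-‖unfold α g‖ ^ 2 / (2 * t)) ≤ latticeSum t ^ M := by
  have h : ∀ g : Fin M → ℤ × Bool, Real.exp (-‖unfold α g‖ ^ 2 / (2 * t)) =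
      ∏ i, Real.exp (-(2 * ((g i).1 : ℝ) + boolSign (g i).2 * (α i : ℝ)) ^ 2 / (2 * t)) := by
    intro g
    rw [EuclideanSpace.real_norm_sq_eq, ← Real.exp_sum, ← Finset.sum_div, Finset.sum_neg_distrib]
    rfl
  simp only [h]
  rw [← Finset.prod_univ_sum (fun _ : Fin M => S ×ˢ (Finset.univ : Finset Bool))
    fun i q => Real.exp (-(2 * (q.1 : ℝ) + boolSign q.2 * (α i : ℝ)) ^ 2 / (2 * t))]
  calc _ ≤ ∏ _i : Fin M, latticeSum t := Finset.prod_le_prod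
        (fun i _ => Finset.sum_nonneg fun _ _ => (Real.exp_pos _).le)
        fun i _ => sum_exp_unfold_le ht S (α i)
    _ = latticeSum t ^ M := by simp

theorem List.sum_map_finset_sum {ι α : Type*} (s : Finset ι) (f : ι → α → ℝ) (l : List α) :
    (l.map fun z => ∑ i ∈ s, f i z).sum = ∑ i ∈ s, (l.map (f i)).sum := by
  induction l with
  | nil => simp
  | cons a l ih => simp [ih, Finset.sum_add_distrib]

open Classical in
theorem exp_le_card_mul_latticeSum_pow {K d : ℕ} (hd : 0 < d) {κ t : ℝ}
    (ht : t⁻¹ = 1 - (κ ^ 2)⁻¹) (hκ : 0 < κ)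
    (ht0 : 0 < t) {ε : ℝ} (L : ℕ) (hL : κ ^ L * ε ≤ 1) {f : Cube (K + d) → Fin K → ℝ}
    (hf : Continuous f) {δ : ℝ} (hδ : 0 < δ) {A : ℕ}
    (hcov : ∀ x₀, ∃ U : Fin A → Set (Cube (K + d)),
      (∀ a, ∀ x ∈ U a, ∀ x' ∈ U a, cubeDist x x' ≤ ε) ∧
      ∀ x, ‖f x - f x₀‖ ≤ δ → ∃ a, x ∈ U a) :
    Real.exp (((L * d : ℕ) - (K + d : ℕ) : ℝ) / (2 * t)) ≤ A * latticeSum t ^ (K + d) := by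
  set pt : Gauss.State K d → Fin (K + d) → ℝ := fun s i => (κ ^ L)⁻¹ * s.1 i with hpt
  set Fd : Gauss.State K d → Cube (K + d) := fun s i => fold (pt s i) with hFd
  have hFd_cont : Continuous Fd := continuous_pi fun i => continuous_fold.comp
    (continuous_const.mul (by fun_prop))
  obtain ⟨l, y, hl, hly⟩ := exists_branching_close (Gauss.continuous_move κ)
    (hf.comp hFd_cont) (L * d) 0 (half_pos hδ)
  have hlen := hl.length_eq
  obtain ⟨z₀, hz₀⟩ : ∃ z, z ∈ l := by
    refine List.exists_mem_of_length_pos ?_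
    rw [hlen]
    positivity
  obtain ⟨U, hU, hUf⟩ := hcov (Fd z₀)
  have hclose : ∀ z ∈ l, ∃ a, Fd z ∈ U a := by
    intro z hz
    refine hUf _ ?_
    have h1 := hly z hz
    have h2 := hly z₀ hz₀
    have h3 := norm_sub_le_norm_sub_add_norm_sub (f (Fd z)) y (f (Fd z₀))
    rw [norm_sub_rev y] at h3
    simp only [Function.comp] at h1 h2
    linarith
  let α : Fin A → Cube (K + d) := fun a => if h : (U a).Nonempty then h.some else 0
  have hα : ∀ a x, x ∈ U a → cubeDist x (α a) ≤ ε := by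
    intro a x hx
    have h : (U a).Nonempty := ⟨x, hx⟩
    refine hU a x hx _ ?_
    simp only [α, dif_pos h]
    exact h.some_mem
  choose q hq using exists_eq_fold
  obtain ⟨S, hS⟩ : ∃ S : Finset ℤ, ∀ z ∈ l, ∀ i, (q (pt z i)).1 ∈ S :=
    ⟨(l.toFinset ×ˢ Finset.univ).image fun p : Gauss.State K d × Fin (K + d) => (q (pt p.1 p.2)).1,
      fun z hz i => Finset.mem_image.2 ⟨(z, i), by simp [hz], rfl⟩⟩
  set G := Fintype.piFinset fun _ : Fin (K + d) => S ×ˢ (Finset.univ : Finset Bool) with hG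
  have hpoint : ∀ z ∈ l, Real.exp (-((K + d : ℕ) : ℝ) / (2 * t)) ≤
      ∑ a, ∑ g ∈ G, Real.exp (-‖z.1 - κ ^ L • unfold (α a) g‖ ^ 2 / (2 * t)) := by
    intro z hz
    obtain ⟨a, ha⟩ := hclose z hz
    have h1 := hα a _ ha
    have hg : (fun i => q (pt z i)) ∈ G := by simp [hG, hS z hz]
    refine le_trans ?_ (Finset.single_le_sum (f := fun a => ∑ g ∈ G,
      Real.exp (-‖z.1 - κ ^ L • unfold (α a) g‖ ^ 2 / (2 * t)))
      (fun a _ => Finset.sum_nonneg fun _ _ => (Real.exp_pos _).le) (Finset.mem_univ a))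
    refine le_trans ?_ (Finset.single_le_sum (f := fun g =>
      Real.exp (-‖z.1 - κ ^ L • unfold (α a) g‖ ^ 2 / (2 * t)))
      (fun g _ => (Real.exp_pos _).le) hg)
    rw [Real.exp_le_exp]
    gcongr
    rw [EuclideanSpace.real_norm_sq_eq]
    have h2 : ∀ i, (z.1 - κ ^ L • unfold (α a) (fun i => q (pt z i))) i ^ 2 ≤ 1 := by
      intro i
      have h3 : |(Fd z i : ℝ) - α a i| ≤ ε := by
        refine le_trans ?_ h1
        exact norm_le_pi_norm ((fun i => (Fd z i : ℝ)) - fun i => (α a i : ℝ)) i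
      have h4 : (z.1 - κ ^ L • unfold (α a) (fun i => q (pt z i))) i =
          κ ^ L * (boolSign (q (pt z i)).2 * ((Fd z i : ℝ) - α a i)) := by
        have h5 : z.1 i = κ ^ L * pt z i := by
          simp only [hpt]
          rw [mul_inv_cancel_left₀ (by positivity)]
        simp only [PiLp.sub_apply, PiLp.smul_apply, smul_eq_mul, unfold]
        rw [h5]
        nth_rewrite 1 [hq (pt z i)]
        simp only [hFd]
        ring
      rw [h4, sq_le_one_iff_abs_le_one, abs_mul, abs_mul, abs_of_pos (by positivity)]
      have h6 : |(boolSign (q (pt z i)).2 : ℝ)| = 1 := by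
        cases (q (pt z i)).2 <;> simp [boolSign]
      rw [h6, one_mul]
      exact (mul_le_mul_of_nonneg_left h3 (by positivity)).trans hL
    calc _ ≤ ∑ _i : Fin (K + d), (1 : ℝ) := Finset.sum_le_sum fun i _ => h2 i
      _ = ((K + d : ℕ) : ℝ) := by simp
  have hsum : (2 : ℝ) ^ (L * d) * Real.exp (-((K + d : ℕ) : ℝ) / (2 * t)) ≤
      ∑ _a : Fin A, (2 * Real.exp (-1 / (2 * t))) ^ (L * d) * latticeSum t ^ (K + d) := by
    calc _ = (l.map fun _ => Real.exp (-((K + d : ℕ) : ℝ) / (2 * t))).sum := by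
          rw [List.map_const', List.sum_replicate, hlen, nsmul_eq_mul]
          push_cast
          rfl
      _ ≤ (l.map fun z => ∑ a, ∑ g ∈ G,
            Real.exp (-‖z.1 - κ ^ L • unfold (α a) g‖ ^ 2 / (2 * t))).sum :=
          List.sum_le_sum hpoint
      _ = ∑ a, ∑ g ∈ G, (l.map fun z =>
            Real.exp (-‖z.1 - κ ^ L • unfold (α a) g‖ ^ 2 / (2 * t))).sum := by
          simp only [List.sum_map_finset_sum]
      _ ≤ ∑ a, ∑ g ∈ G, (2 * Real.exp (-1 / (2 * t))) ^ (L * d) *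
            Real.exp (-‖unfold (α a) g‖ ^ 2 / (2 * t)) :=
          Finset.sum_le_sum fun a _ => Finset.sum_le_sum fun g _ =>
            Gauss.sum_exp_le_of_zero hd ht hκ.ne' ht0 hl _
      _ ≤ _ := by
          refine Finset.sum_le_sum fun a _ => ?_
          rw [← Finset.mul_sum]
          exact mul_le_mul_of_nonneg_left (sum_exp_norm_unfold_le ht0 S (α a)) (by positivity)
  rw [Finset.sum_const, Finset.card_univ, Fintype.card_fin, nsmul_eq_mul, mul_pow,
    ← Real.exp_nat_mul] at hsum
  have h2 : (0 : ℝ) < 2 ^ (L * d) := by positivity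
  have h7 : Real.exp (-((K + d : ℕ) : ℝ) / (2 * t)) ≤
      Real.exp ((L * d : ℕ) * (-1 / (2 * t))) * (A * latticeSum t ^ (K + d)) := by
    refine le_of_mul_le_mul_left (hsum.trans_eq ?_) h2
    ring
  have h8 : ((L * d : ℕ) - (K + d : ℕ) : ℝ) / (2 * t) =
      -((L * d : ℕ) * (-1 / (2 * t))) + -((K + d : ℕ) : ℝ) / (2 * t) := by ring
  rw [h8, Real.exp_add, Real.exp_neg]
  exact (inv_mul_le_iff₀ (Real.exp_pos _)).2 h7

/-- The quality of the waist inequality with parameter `κ`. -/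
noncomputable def waistRate (κ : ℝ) : ℝ := (1 - (κ ^ 2)⁻¹) / (2 * Real.log κ)

/-- The additive constant in the waist inequality with parameter `κ`. -/
noncomputable def waistConst (κ : ℝ) : ℝ :=
  |Real.log (latticeSum (1 - (κ ^ 2)⁻¹)⁻¹)| + (1 - (κ ^ 2)⁻¹)

theorem waistConst_nonneg {κ : ℝ} (hκ : 1 < κ) : 0 ≤ waistConst κ := by
  have : (κ ^ 2)⁻¹ ≤ 1 := inv_le_one_of_one_le₀ (one_le_pow₀ hκ.le)
  unfold waistConst
  have := abs_nonneg (Real.log (latticeSum (1 - (κ ^ 2)⁻¹)⁻¹))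
  linarith

theorem waistRate_pos {κ : ℝ} (hκ : 1 < κ) : 0 < waistRate κ := by
  have : (κ ^ 2)⁻¹ < 1 := inv_lt_one_of_one_lt₀ (one_lt_pow₀ hκ two_ne_zero)
  have := Real.log_pos hκ
  unfold waistRate
  have : 0 < 1 - (κ ^ 2)⁻¹ := by linarith
  positivity

/-- A covering form of the waist inequality: if all fibres of a map from the cube of dimension
`K + d` to `ℝ^K` are covered, with some room, by `A` sets of diameter at most `ε`, then `A` is at
least of the order `ε^{-d}`, up to factors exponential in the dimension. -/
theorem waist_covering {K d : ℕ} {κ : ℝ} (hκ : 1 < κ) {ε : ℝ} (hε : 0 < ε) (hε1 : ε < 1)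
    {f : Cube (K + d) → Fin K → ℝ} (hf : Continuous f) {δ : ℝ} (hδ : 0 < δ) {A : ℕ}
    (hcov : ∀ x₀, ∃ U : Fin A → Set (Cube (K + d)),
      (∀ a, ∀ x ∈ U a, ∀ x' ∈ U a, cubeDist x x' ≤ ε) ∧
      ∀ x, ‖f x - f x₀‖ ≤ δ → ∃ a, x ∈ U a) :
    waistRate κ * d * Real.log (1 / ε) ≤ Real.log A + waistConst κ * (K + d : ℕ) := by
  rcases Nat.eq_zero_or_pos d with rfl | hd
  · have h1 : 0 ≤ Real.log A := Real.log_natCast_nonneg A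
    have h2 := mul_nonneg (waistConst_nonneg hκ) (Nat.cast_nonneg (α := ℝ) (K + 0))
    simp only [Nat.cast_zero, mul_zero, zero_mul]
    linarith
  have hκ0 : 0 < κ := by linarith
  have hκ2 : (κ ^ 2)⁻¹ < 1 := inv_lt_one_of_one_lt₀ (one_lt_pow₀ hκ two_ne_zero)
  set θ := 1 - (κ ^ 2)⁻¹ with hθ
  have hθ0 : 0 < θ := by linarith
  have hlog := Real.log_pos hκ
  have hlogε : 0 < Real.log (1 / ε) := Real.log_pos (by rwa [lt_div_iff₀ hε, one_mul])
  set L := ⌊Real.log (1 / ε) / Real.log κ⌋₊ with hLdef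
  have hL : κ ^ L * ε ≤ 1 := by
    rw [← le_div_iff₀ hε, ← Real.log_le_log_iff (by positivity) (by positivity), Real.log_pow,
      ← le_div_iff₀ hlog]
    exact Nat.floor_le (by positivity)
  have hL' : Real.log (1 / ε) / Real.log κ < L + 1 := Nat.lt_floor_add_one _
  have h := exp_le_card_mul_latticeSum_pow hd (inv_inv θ) hκ0 (inv_pos.2 hθ0) L hL hf hδ hcov
  have hpos := latticeSum_pos (inv_pos.2 hθ0)
  have hA : A ≠ 0 := by
    rintro rfl
    simp at h
    exact absurd h (not_le.2 (Real.exp_pos _))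
  have h' := (Real.le_log_iff_exp_le (by positivity)).2 h
  rw [Real.log_mul (by positivity) (by positivity), Real.log_pow] at h'
  have h1 : (((K + d : ℕ) : ℝ)) * Real.log (latticeSum θ⁻¹) ≤
      |Real.log (latticeSum θ⁻¹)| * (K + d : ℕ) := by
    rw [mul_comm]
    exact mul_le_mul_of_nonneg_right (le_abs_self _) (Nat.cast_nonneg _)
  have h2 : (((L * d : ℕ) - (K + d : ℕ) : ℝ) / (2 * θ⁻¹)) =
      θ / 2 * (L * d - (K + d : ℕ)) := by
    push_cast
    field_simp
  have h3 : waistRate κ * d * Real.log (1 / ε) ≤ θ / 2 * (L * d + d) := by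
    have : waistRate κ * d * Real.log (1 / ε) =
        θ / 2 * d * (Real.log (1 / ε) / Real.log κ) := by
      rw [waistRate]
      field_simp
      rw [hθ]
      field_simp
    rw [this]
    have h4 := mul_le_mul_of_nonneg_left hL'.le (by positivity : 0 ≤ θ / 2 * d)
    linarith
  have h5 : (d : ℝ) ≤ (K + d : ℕ) := by push_cast; linarith [Nat.cast_nonneg (α := ℝ) K]
  rw [h2] at h'
  have h6 := mul_le_mul_of_nonneg_left h5 (by positivity : 0 ≤ θ / 2)
  rw [waistConst, ← hθ]
  linarith

section DynDist

variable {X : Type*} {T : X → X} {d : X → X → ℝ}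

theorem le_dynDist {N n : ℕ} (hn : n < N) (x y : X) :
    d (T^[n] x) (T^[n] y) ≤ dynDist T d N x y := by
  refine le_csSup (Set.Finite.bddAbove ?_) ⟨n, hn, rfl⟩
  refine ((Finset.range N).finite_toSet.image fun n => d (T^[n] x) (T^[n] y)).subset ?_
  rintro r ⟨n, hn, rfl⟩
  exact ⟨n, by simpa using hn, rfl⟩

theorem dynDist_le {N : ℕ} {x y : X} {c : ℝ} (hc : 0 ≤ c)
    (h : ∀ n < N, d (T^[n] x) (T^[n] y) ≤ c) : dynDist T d N x y ≤ c :=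
  Real.sSup_le (by rintro r ⟨n, hn, rfl⟩; exact h n hn) hc

theorem le_of_setEDiam_lt {ρ : X → X → ℝ} {E : Set X} {ε : ℝ} (hε : 0 < ε)
    (h : setEDiam ρ E < ENNReal.ofReal ε) {x y : X} (hx : x ∈ E) (hy : y ∈ E) : ρ x y ≤ ε := by
  have h1 : ENNReal.ofReal (ρ x y) ≤ setEDiam ρ E := by
    refine le_trans ?_ (le_iSup₂ (f := fun x _ => ⨆ y ∈ E, ENNReal.ofReal (ρ x y)) x hx)
    exact le_iSup₂ (f := fun y _ => ENNReal.ofReal (ρ x y)) y hy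
  exact (ENNReal.ofReal_le_ofReal_iff hε.le).1 (h1.trans h.le)

theorem supLogCov_nonneg {Y : Type*} (π : X → Y) (ρ : X → X → ℝ) (ε : ℝ) : 0 ≤ supLogCov π ρ ε :=
  Real.iSup_nonneg fun _ => Real.log_natCast_nonneg _

variable [MetricSpace X]

theorem dynDist_nonneg (N : ℕ) (x y : X) : 0 ≤ dynDist T dist N x y :=
  Real.sSup_nonneg (by rintro r ⟨n, -, rfl⟩; exact dist_nonneg)

theorem dynDist_triangle (N : ℕ) (x y z : X) :
    dynDist T dist N x z ≤ dynDist T dist N x y + dynDist T dist N y z :=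
  dynDist_le (add_nonneg (dynDist_nonneg _ _ _) (dynDist_nonneg _ _ _)) fun _ hn =>
    (dist_triangle _ _ _).trans (add_le_add (le_dynDist hn _ _) (le_dynDist hn _ _))

theorem dynDist_comm (N : ℕ) (x y : X) : dynDist T dist N x y = dynDist T dist N y x := by
  simp only [dynDist, dist_comm]

theorem eventually_dynDist_lt (hT : Continuous T) (N : ℕ) (x : X) {δ : ℝ} (hδ : 0 < δ) :
    ∀ᶠ y in 𝓝 x, dynDist T dist N x y < δ := by
  have h : ∀ᶠ y in 𝓝 x, ∀ n ∈ Finset.range N, dist (T^[n] x) (T^[n] y) < δ / 2 := by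
    rw [Filter.eventually_all_finset]
    intro n _
    have : Tendsto (fun y => dist (T^[n] x) (T^[n] y)) (𝓝 x) (𝓝 (dist (T^[n] x) (T^[n] x))) :=
      (continuous_const.dist (hT.iterate n)).tendsto x
    rw [dist_self] at this
    exact this.eventually_lt_const (by positivity)
  filter_upwards [h] with y hy
  exact (dynDist_le (by positivity) fun n hn => (hy n (Finset.mem_range.2 hn)).le).trans_lt
    (half_lt_self hδ)

theorem ROpen.isOpen (hT : Continuous T) {N : ℕ} {U : Set X} (hU : ROpen (dynDist T dist N) U) :
    IsOpen U := by
  rw [isOpen_iff_mem_nhds]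
  intro x hx
  obtain ⟨δ, hδ, h⟩ := hU x hx
  filter_upwards [eventually_dynDist_lt hT N x hδ] with y hy using h y hy

theorem exists_covering_univ [CompactSpace X] (hT : Continuous T) (N : ℕ) {ε : ℝ} (hε : 0 < ε) :
    ∃ (n : ℕ) (U : Fin n → Set X), (∀ i, ROpen (dynDist T dist N) (U i)) ∧
      (∀ i, setEDiam (dynDist T dist N) (U i) < ENNReal.ofReal ε) ∧ Set.univ ⊆ ⋃ i, U i := by
  obtain ⟨t, ht⟩ := CompactSpace.elim_nhds_subcover
    (fun x : X => {y | dynDist T dist N x y < ε / 3})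
    fun x => eventually_dynDist_lt hT N x (by positivity)
  refine ⟨t.card, fun i => {y | dynDist T dist N (t.equivFin.symm i : X) y < ε / 3},
    fun i y hy => ?_, fun i => ?_, fun x _ => ?_⟩
  · have hy' : dynDist T dist N (t.equivFin.symm i : X) y < ε / 3 := hy
    refine ⟨ε / 3 - dynDist T dist N (t.equivFin.symm i : X) y, by linarith, fun z hz => ?_⟩
    show dynDist T dist N (t.equivFin.symm i : X) z < ε / 3
    linarith [dynDist_triangle (T := T) N (t.equivFin.symm i : X) y z]
  · refine lt_of_le_of_lt (b := ENNReal.ofReal (2 * (ε / 3))) ?_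
      ((ENNReal.ofReal_lt_ofReal_iff hε).2 (by linarith))
    refine iSup₂_le fun y hy => iSup₂_le fun z hz => ENNReal.ofReal_le_ofReal ?_
    have hy' : dynDist T dist N (t.equivFin.symm i : X) y < ε / 3 := hy
    have hz' : dynDist T dist N (t.equivFin.symm i : X) z < ε / 3 := hz
    rw [dynDist_comm] at hy'
    linarith [dynDist_triangle (T := T) N y (t.equivFin.symm i : X) z]
  · have hx : x ∈ ⋃ x ∈ t, {y | dynDist T dist N x y < ε / 3} := by rw [ht]; trivial
    simp only [Set.mem_iUnion] at hx ⊢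
    obtain ⟨c, hc, hxc⟩ := hx
    exact ⟨t.equivFin ⟨c, hc⟩, by simpa using hxc⟩

variable {Y : Type*} {π : X → Y}

/-- Each fiber is covered by at most `exp (supLogCov …)` small open sets. -/
theorem exists_fiber_covering [CompactSpace X] (hT : Continuous T) (N : ℕ) {ε : ℝ} (hε : 0 < ε)
    (x₀ : X) :
    ∃ U : Fin ⌊Real.exp (supLogCov π (dynDist T dist N) ε)⌋₊ → Set X, (∀ i, IsOpen (U i)) ∧
      (∀ i, ∀ x ∈ U i, ∀ y ∈ U i, dynDist T dist N x y ≤ ε) ∧ π ⁻¹' {π x₀} ⊆ ⋃ i, U i := by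
  obtain ⟨n, V, hV1, hV2, hV3⟩ := exists_covering_univ hT N hε
  have hle : ∀ y, covNum (dynDist T dist N) ε (π ⁻¹' {y}) ≤ n := fun y =>
    Nat.sInf_le ⟨V, hV1, hV2, (Set.subset_univ _).trans hV3⟩
  have hbdd : BddAbove (Set.range fun y =>
      Real.log (covNum (dynDist T dist N) ε (π ⁻¹' {y}) : ℝ)) := by
    refine ⟨Real.log n, ?_⟩
    rintro _ ⟨y, rfl⟩
    rcases Nat.eq_zero_or_pos (covNum (dynDist T dist N) ε (π ⁻¹' {y})) with h | h
    · simp only [h, Nat.cast_zero, Real.log_zero]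
      exact Real.log_natCast_nonneg n
    · exact Real.log_le_log (by exact_mod_cast h) (by exact_mod_cast hle y)
  obtain ⟨U, hU1, hU2, hU3⟩ := Nat.sInf_mem
    (s := {n : ℕ | ∃ U : Fin n → Set X, (∀ i, ROpen (dynDist T dist N) (U i)) ∧
      (∀ i, setEDiam (dynDist T dist N) (U i) < ENNReal.ofReal ε) ∧ π ⁻¹' {π x₀} ⊆ ⋃ i, U i})
    ⟨n, V, hV1, hV2, (Set.subset_univ _).trans hV3⟩
  change Fin (covNum (dynDist T dist N) ε (π ⁻¹' {π x₀})) → Set X at U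
  have hx₀ : ∃ i, x₀ ∈ U i := Set.mem_iUnion.1 (hU3 (show x₀ ∈ π ⁻¹' {π x₀} from rfl))
  have hpos : 0 < covNum (dynDist T dist N) ε (π ⁻¹' {π x₀}) := hx₀.choose.pos
  have hc : covNum (dynDist T dist N) ε (π ⁻¹' {π x₀}) ≤
      ⌊Real.exp (supLogCov π (dynDist T dist N) ε)⌋₊ := by
    refine Nat.le_floor ?_
    rw [← Real.log_le_iff_le_exp (by exact_mod_cast hpos)]
    exact le_ciSup hbdd (π x₀)
  refine ⟨fun i => if h : (i : ℕ) < covNum (dynDist T dist N) ε (π ⁻¹' {π x₀}) then U ⟨i, h⟩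
    else ∅, fun i => ?_, fun i => ?_, fun x hx => ?_⟩
  · dsimp only
    split_ifs with h
    · exact (hU1 _).isOpen hT
    · exact isOpen_empty
  · dsimp only
    split_ifs with h
    · exact fun x hx y hy => le_of_setEDiam_lt hε (hU2 _) hx hy
    · simp
  · obtain ⟨i, hi⟩ := Set.mem_iUnion.1 (hU3 hx)
    have hlt : (i : ℕ) < covNum (dynDist T dist N) ε (π ⁻¹' {π x₀}) := i.2
    refine Set.mem_iUnion_of_mem ⟨i, hlt.trans_le hc⟩ ?_
    dsimp only
    split_ifs
    exact hi

end DynDist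

/-- Points of the full shift whose coordinates in the window `[-m, m]` differ by at most
`1 / (m + 1)`. -/
def cylinderEntourage (b m : ℕ) : Set (FullShift b × FullShift b) :=
  {p | ∀ k : ℤ, |k| ≤ m → ∀ i, |(p.1 k i : ℝ) - p.2 k i| ≤ 1 / ((m : ℝ) + 1)}

theorem isClosed_cylinderEntourage (b m : ℕ) : IsClosed (cylinderEntourage b m) := by
  have : cylinderEntourage b m = ⋂ (k : ℤ) (_ : |k| ≤ m) (i : Fin b),
      {p | |(p.1 k i : ℝ) - p.2 k i| ≤ 1 / ((m : ℝ) + 1)} := by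
    ext p
    simp [cylinderEntourage]
  rw [this]
  refine isClosed_iInter fun k => isClosed_iInter fun _ => isClosed_iInter fun i =>
    isClosed_le (by fun_prop) continuous_const

theorem exists_cylinderEntourage_subset {b : ℕ} {V : Set (FullShift b × FullShift b)}
    (hV : V ∈ uniformity (FullShift b)) : ∃ m, cylinderEntourage b m ⊆ V := by
  have hanti : Antitone (cylinderEntourage b) := by
    intro m n hmn p hp k hk i
    refine (hp k (hk.trans (by exact_mod_cast hmn)) i).trans ?_
    have : (m : ℝ) ≤ n := by exact_mod_cast hmn
    exact one_div_le_one_div_of_le (by positivity) (by linarith)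
  refine exists_subset_nhds_of_isCompact' (directed_of_isDirected_le hanti)
    (fun m => (isClosed_cylinderEntourage b m).isCompact) (isClosed_cylinderEntourage b) ?_
  rintro ⟨y, z⟩ hyz
  have hyz' : y = z := by
    funext k i
    have h : ∀ n : ℕ, |(y k i : ℝ) - z k i| ≤ 1 / ((n : ℝ) + 1) := by
      intro n
      have h1 : |k| ≤ ((max n k.natAbs : ℕ) : ℤ) := by
        rw [Int.abs_eq_natAbs]
        exact_mod_cast le_max_right _ _
      refine ((Set.mem_iInter.1 hyz (max n k.natAbs)) k h1 i).trans ?_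
      have : (n : ℝ) ≤ (max n k.natAbs : ℕ) := by exact_mod_cast le_max_left _ _
      exact one_div_le_one_div_of_le (by positivity) (by linarith)
    have h0 := ge_of_tendsto' (tendsto_one_div_add_atTop_nhds_zero_nat (𝕜 := ℝ)) h
    exact Subtype.ext (sub_eq_zero.1 (abs_eq_zero.1 (le_antisymm h0 (abs_nonneg _))))
  subst hyz'
  exact nhds_le_uniformity y hV

/-- If all fibers of `π` are covered by `A` small open sets, then so are the preimages of
cylinders of a uniform size. -/
theorem exists_cylinder_covering {X : Type*} [TopologicalSpace X] [CompactSpace X] {b A : ℕ}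
    {π : X → FullShift b} (hπ : Continuous π) {P : Set X → Prop}
    (h : ∀ x₀, ∃ U : Fin A → Set X, (∀ i, IsOpen (U i)) ∧ (∀ i, P (U i)) ∧
      π ⁻¹' {π x₀} ⊆ ⋃ i, U i) :
    ∃ m, ∀ x₀, ∃ U : Fin A → Set X, (∀ i, P (U i)) ∧
      ∀ x, (π x, π x₀) ∈ cylinderEntourage b m → ∃ i, x ∈ U i := by
  choose U hUo hUP hU using h
  have hcl := hπ.isClosedMap
  obtain ⟨V, hV, hVU⟩ := lebesgue_number_lemma (K := Set.range π)
    (U := fun x₀ : X => (π '' (⋃ i, U x₀ i)ᶜ)ᶜ) (isCompact_range hπ)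
    (fun x₀ => (hcl _ (isOpen_iUnion (hUo x₀)).isClosed_compl).isOpen_compl) (by
      rintro _ ⟨x₀, rfl⟩
      refine Set.mem_iUnion.2 ⟨x₀, ?_⟩
      rintro ⟨x, hx, hxx⟩
      exact hx (hU x₀ hxx))
  obtain ⟨m, hm⟩ := exists_cylinderEntourage_subset (symm_le_uniformity hV)
  refine ⟨m, fun x₀ => ?_⟩
  obtain ⟨x₁, hx₁⟩ := hVU (π x₀) ⟨x₀, rfl⟩
  refine ⟨U x₁, hUP x₁, fun x hx => ?_⟩
  have h1 : π x ∈ (π '' (⋃ i, U x₁ i)ᶜ)ᶜ := hx₁ (hm hx)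
  by_contra hcon
  exact h1 ⟨x, fun hx' => hcon (Set.mem_iUnion.1 hx'), rfl⟩

theorem apply_iterate_of_equivariant {X α : Type*} {T : X → X} {π : X → ℤ → α}
    (h : ∀ x, π (T x) = shift (π x)) (n : ℕ) (x : X) (k : ℤ) :
    π (T^[n] x) k = π x (k + n) := by
  induction n generalizing x with
  | zero => simp
  | succ n ih =>
    rw [Function.iterate_succ_apply, ih, h, shift]
    push_cast
    ring_nf

/-- The lower bound for a single embedded cube, from coverings of fibers over blocks of
length `p`. -/
theorem exists_block_bound {X : Type*} [MetricSpace X] [CompactSpace X] {T : X → X}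
    (hT : Continuous T) {b : ℕ} {π : X → FullShift b} (hπ : Continuous π)
    (hequiv : ∀ x, π (T x) = shift (π x)) {κ : ℝ} (hκ : 1 < κ) {ε : ℝ} (hε : 0 < ε) (hε1 : ε < 1)
    {p : ℕ} (hp : 0 < p) :
    ∃ l : ℕ, ∀ (N M : ℕ) (ψ : Cube M → X), Continuous ψ →
      (∀ x y, cubeDist x y ≤ dynDist T dist N (ψ x) (ψ y)) →
      waistRate κ * (M - ((b * ((N / p + 1) * p + l) : ℕ) : ℝ)) * Real.log (1 / ε) ≤
        ((N / p + 1 : ℕ) : ℝ) * supLogCov π (dynDist T dist p) ε + waistConst κ * M := by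
  set S := supLogCov π (dynDist T dist p) ε with hS
  have hS0 : 0 ≤ S := supLogCov_nonneg _ _ _
  obtain ⟨m, hm⟩ := exists_cylinder_covering hπ
    (P := fun U => ∀ x ∈ U, ∀ y ∈ U, dynDist T dist p x y ≤ ε)
    fun x₀ => exists_fiber_covering hT p hε x₀
  refine ⟨2 * m + 1, fun N M ψ hψ hexp => ?_⟩
  set A := ⌊Real.exp S⌋₊ with hA
  set r := N / p + 1 with hr
  set I := Finset.Icc (-(m : ℤ)) ((r * p + m : ℕ) : ℤ) with hI
  have hcard : Fintype.card (I × Fin b) = b * (r * p + (2 * m + 1)) := by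
    rw [Fintype.card_prod, Fintype.card_coe, Int.card_Icc, Fintype.card_fin, mul_comm]
    congr 1
    omega
  set K := b * (r * p + (2 * m + 1)) with hK
  have hlog : 0 < Real.log (1 / ε) := Real.log_pos (by rwa [lt_div_iff₀ hε, one_mul])
  rcases Nat.lt_or_ge M K with hMK | hMK
  · have h1 : (M : ℝ) - (K : ℝ) ≤ 0 := sub_nonpos.2 (by exact_mod_cast hMK.le)
    have h2 : waistRate κ * (M - (K : ℝ)) * Real.log (1 / ε) ≤ 0 :=
      mul_nonpos_of_nonpos_of_nonneg
        (mul_nonpos_of_nonneg_of_nonpos (waistRate_pos hκ).le h1) hlog.le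
    have h3 := waistConst_nonneg hκ
    exact h2.trans (by positivity)
  obtain ⟨d, rfl⟩ := Nat.exists_eq_add_of_le hMK
  let e : I × Fin b ≃ Fin K := Fintype.equivFinOfCardEq hcard
  let g : (Fin r → Fin A) ≃ Fin (A ^ r) := Fintype.equivFinOfCardEq (by simp)
  let f : Cube (K + d) → Fin K → ℝ := fun x j => π (ψ x) (e.symm j).1 (e.symm j).2
  have hf : Continuous f := by fun_prop
  have key := waist_covering hκ hε hε1 hf (δ := 1 / ((m : ℝ) + 1)) (by positivity) (A := A ^ r) (by
    intro x₀
    choose U hU hcov using fun j : Fin r => hm (T^[j * p] (ψ x₀))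
    refine ⟨fun a => {x | ∀ j, T^[j * p] (ψ x) ∈ U j (g.symm a j)}, ?_, ?_⟩
    · intro a x hx y hy
      refine (hexp x y).trans (dynDist_le hε.le fun n hn => ?_)
      have hlt : n / p < r := Nat.lt_succ_of_le (Nat.div_le_div_right hn.le)
      have h1 := hU ⟨n / p, hlt⟩ _ _ (hx ⟨n / p, hlt⟩) _ (hy ⟨n / p, hlt⟩)
      have h2 := (le_dynDist (T := T) (d := dist) (Nat.mod_lt n hp) _ _).trans h1
      rw [← Function.iterate_add_apply, ← Function.iterate_add_apply] at h2
      have h3 : n % p + n / p * p = n := by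
        rw [mul_comm]
        exact Nat.mod_add_div n p
      simpa only [h3] using h2
    · intro x hx
      have h : ∀ j : Fin r, ∃ i, T^[j * p] (ψ x) ∈ U j i := by
        intro j
        refine hcov j _ fun k hk i => ?_
        dsimp only
        rw [apply_iterate_of_equivariant hequiv, apply_iterate_of_equivariant hequiv]
        have hkI : k + ((j * p : ℕ) : ℤ) ∈ I := by
          have h1 : ((j * p : ℕ) : ℤ) ≤ ((r * p : ℕ) : ℤ) := by
            exact_mod_cast Nat.mul_le_mul_right p j.2.le
          have h2 := abs_le.1 hk
          rw [hI, Finset.mem_Icc]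
          push_cast at h1 h2 ⊢
          constructor
          · have : (0 : ℤ) ≤ (j : ℕ) * (p : ℤ) := by positivity
            linarith [h2.1]
          · linarith [h2.2]
        have h1 := (norm_le_pi_norm (f x - f x₀) (e (⟨_, hkI⟩, i))).trans hx
        simpa [f] using h1
      choose a ha using h
      exact ⟨g a, fun j => by simpa using ha j⟩)
  have hA1 : Real.log (A ^ r : ℕ) ≤ r * S := by
    rw [Nat.cast_pow, Real.log_pow]
    refine mul_le_mul_of_nonneg_left ?_ (Nat.cast_nonneg _)
    rcases Nat.eq_zero_or_pos A with h | h
    · simpa [h] using hS0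
    · rw [Real.log_le_iff_le_exp (by exact_mod_cast h)]
      exact Nat.floor_le (Real.exp_pos _).le
  have h4 : ((K + d : ℕ) : ℝ) - (K : ℝ) = d := by push_cast; ring
  rw [h4]
  linarith

theorem tendsto_waistRate : Tendsto waistRate (𝓝[>] 1) (𝓝 1) := by
  have hid : Tendsto (fun κ : ℝ => κ) (𝓝[>] 1) (𝓝 1) :=
    tendsto_nhdsWithin_of_tendsto_nhds tendsto_id
  have h1 : Tendsto (fun κ : ℝ => (κ + 1) / (2 * κ ^ 2)) (𝓝[>] 1) (𝓝 1) := by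
    have := (hid.add_const 1).div ((hid.pow 2).const_mul 2) (by norm_num)
    norm_num at this
    exact this
  have h2 : Tendsto (fun κ : ℝ => (1 + κ⁻¹) / 2) (𝓝[>] 1) (𝓝 1) := by
    have := ((hid.inv₀ one_ne_zero).const_add 1).div_const 2
    norm_num at this
    exact this
  refine tendsto_of_tendsto_of_tendsto_of_le_of_le' h1 h2 ?_ ?_
  · filter_upwards [self_mem_nhdsWithin] with κ hκ
    have hκ1 : 1 < κ := hκ
    have hlog := Real.log_pos hκ1
    have h := Real.log_le_sub_one_of_pos (zero_lt_one.trans hκ1)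
    have h0 : 0 < κ := by linarith
    rw [waistRate, le_div_iff₀ (by positivity)]
    have h3 : 1 - (κ ^ 2)⁻¹ = (κ + 1) / (2 * κ ^ 2) * (2 * (κ - 1)) := by
      field_simp
      ring
    rw [h3]
    gcongr
  · filter_upwards [self_mem_nhdsWithin] with κ hκ
    have hκ1 : 1 < κ := hκ
    have hlog := Real.log_pos hκ1
    have h := Real.one_sub_inv_le_log_of_pos (zero_lt_one.trans hκ1)
    have h0 : 0 < κ := by linarith
    rw [waistRate, div_le_iff₀ (by positivity)]
    have h3 : 1 - (κ ^ 2)⁻¹ = (1 + κ⁻¹) / 2 * (2 * (1 - κ⁻¹)) := by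
      field_simp
      ring
    rw [h3]
    gcongr

section EmbeddedCubes

variable {s : ℝ} {X : Type*} [MetricSpace X] [CompactSpace X] {T : X → X} {N M : ℕ → ℕ}
  {ψ : ∀ n, Cube (M n) → X} {b : ℕ} {π : X → FullShift b}

theorem le_supLogCov_div (hT : Continuous T) (hψcont : ∀ n, Continuous (ψ n))
    (hN : Tendsto N atTop atTop) (hMN : Tendsto (fun n => (M n : ℝ) / (N n : ℝ)) atTop (𝓝 s))
    (hexp : ∀ (n : ℕ) (x y : Cube (M n)), cubeDist x y ≤ dynDist T dist (N n) (ψ n x) (ψ n y))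
    (hπ : Continuous π) (hequiv : ∀ x, π (T x) = shift (π x)) {κ : ℝ} (hκ : 1 < κ) {ε : ℝ}
    (hε : 0 < ε) (hε1 : ε < 1) {p : ℕ} (hp : 0 < p) :
    waistRate κ * (s - b) * Real.log (1 / ε) - waistConst κ * s ≤
      supLogCov π (dynDist T dist p) ε / p := by
  obtain ⟨l, hl⟩ := exists_block_bound hT hπ hequiv hκ hε hε1 hp
  set S := supLogCov π (dynDist T dist p) ε
  have hS0 : 0 ≤ S := supLogCov_nonneg _ _ _
  have hlog : 0 < Real.log (1 / ε) := Real.log_pos (by rwa [lt_div_iff₀ hε, one_mul])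
  have hq := waistRate_pos hκ
  have hNr : Tendsto (fun n => (N n : ℝ)) atTop atTop := tendsto_natCast_atTop_atTop.comp hN
  have hpr : (0 : ℝ) < p := by exact_mod_cast hp
  have hleft : Tendsto (fun n => waistRate κ * ((M n : ℝ) / N n - b * (1 + (p + l) / (N n : ℝ))) *
      Real.log (1 / ε) - waistConst κ * ((M n : ℝ) / N n)) atTop
      (𝓝 (waistRate κ * (s - b) * Real.log (1 / ε) - waistConst κ * s)) := by
    have h1 : Tendsto (fun n => (b : ℝ) * (1 + (p + l) / (N n : ℝ))) atTop (𝓝 (b * (1 + 0))) :=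
      ((tendsto_const_nhds.div_atTop hNr).const_add 1).const_mul _
    rw [add_zero, mul_one] at h1
    exact (((hMN.sub h1).const_mul _).mul_const _).sub (hMN.const_mul _)
  have hright : Tendsto (fun n => (1 / (p : ℝ) + 1 / (N n : ℝ)) * S) atTop (𝓝 (S / p)) := by
    have := ((tendsto_const_nhds (x := (1 : ℝ)).div_atTop hNr).const_add (1 / (p : ℝ))).mul_const S
    rwa [add_zero, one_div_mul_eq_div] at this
  refine le_of_tendsto_of_tendsto hleft hright ?_
  filter_upwards [hN.eventually_gt_atTop 0] with n hn
  have hn' : (0 : ℝ) < N n := by exact_mod_cast hn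
  have h := hl (N n) (M n) (ψ n) (hψcont n) (hexp n)
  have h1 : ((N n / p + 1 : ℕ) : ℝ) ≤ N n / p + 1 := by
    push_cast
    gcongr
    exact Nat.cast_div_le
  have h2 : ((b * ((N n / p + 1) * p + l) : ℕ) : ℝ) ≤ b * (N n + (p + l)) := by
    have h3 : ((N n / p + 1 : ℕ) : ℝ) * p ≤ N n + p := by
      refine (mul_le_mul_of_nonneg_right h1 hpr.le).trans_eq ?_
      field_simp
    rw [Nat.cast_mul, Nat.cast_add, Nat.cast_mul]
    refine mul_le_mul_of_nonneg_left ?_ (Nat.cast_nonneg _)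
    linarith
  have h4 : waistRate κ * (M n - b * (N n + (p + l))) * Real.log (1 / ε) ≤
      (N n / p + 1) * S + waistConst κ * M n :=
    calc _ ≤ waistRate κ * (M n - ((b * ((N n / p + 1) * p + l) : ℕ) : ℝ)) *
          Real.log (1 / ε) := by gcongr
      _ ≤ _ := h
      _ ≤ _ := by gcongr
  rw [← mul_le_mul_iff_of_pos_left hn']
  calc _ = waistRate κ * (M n - b * (N n + (p + l))) * Real.log (1 / ε) -
        waistConst κ * M n := by field_simp
    _ ≤ (N n / p + 1) * S := by linarith
    _ = _ := by field_simp

theorem le_condMdimRate (hT : Continuous T) (hψcont : ∀ n, Continuous (ψ n))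
    (hN : Tendsto N atTop atTop) (hMN : Tendsto (fun n => (M n : ℝ) / (N n : ℝ)) atTop (𝓝 s))
    (hexp : ∀ (n : ℕ) (x y : Cube (M n)), cubeDist x y ≤ dynDist T dist (N n) (ψ n x) (ψ n y))
    (hπ : Continuous π) (hequiv : ∀ x, π (T x) = shift (π x)) {κ : ℝ} (hκ : 1 < κ) {ε : ℝ}
    (hε : 0 < ε) (hε1 : ε < 1) :
    ((waistRate κ * (s - b) - waistConst κ * s / Real.log (1 / ε) : ℝ) : EReal) ≤
      condMdimRate π T dist ε := by
  have hlog : 0 < Real.log (1 / ε) := Real.log_pos (by rwa [lt_div_iff₀ hε, one_mul])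
  refine le_liminf_of_le (by isBoundedDefault) ?_
  filter_upwards [eventually_gt_atTop 0] with p hp
  have hpr : (0 : ℝ) < p := by exact_mod_cast hp
  have h := le_supLogCov_div hT hψcont hN hMN hexp hπ hequiv hκ hε hε1 hp
  rw [EReal.coe_le_coe_iff, ← div_div, le_div_iff₀ hlog]
  refine le_trans (le_of_eq ?_) h
  field_simp

theorem le_lowerCondMdimM (hT : Continuous T) (hψcont : ∀ n, Continuous (ψ n))
    (hN : Tendsto N atTop atTop) (hMN : Tendsto (fun n => (M n : ℝ) / (N n : ℝ)) atTop (𝓝 s))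
    (hexp : ∀ (n : ℕ) (x y : Cube (M n)), cubeDist x y ≤ dynDist T dist (N n) (ψ n x) (ψ n y))
    (hπ : Continuous π) (hequiv : ∀ x, π (T x) = shift (π x)) :
    ((s - b : ℝ) : EReal) ≤ lowerCondMdimM π T dist := by
  have hlim : Tendsto (fun κ => ((waistRate κ * (s - b) : ℝ) : EReal)) (𝓝[>] 1)
      (𝓝 ((s - b : ℝ) : EReal)) := by
    rw [EReal.tendsto_coe]
    simpa using tendsto_waistRate.mul_const (s - b)
  refine le_of_tendsto hlim ?_
  filter_upwards [self_mem_nhdsWithin] with κ hκ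
  have hlog : Tendsto (fun ε : ℝ => Real.log (1 / ε)) (𝓝[>] 0) atTop := by
    simp only [one_div]
    exact Real.tendsto_log_atTop.comp tendsto_inv_nhdsGT_zero
  have h : Tendsto (fun ε : ℝ =>
      ((waistRate κ * (s - b) - waistConst κ * s / Real.log (1 / ε) : ℝ) : EReal)) (𝓝[>] 0)
      (𝓝 ((waistRate κ * (s - b) : ℝ) : EReal)) := by
    rw [EReal.tendsto_coe]
    simpa using (tendsto_const_nhds (x := waistRate κ * (s - b))).sub
      ((tendsto_const_nhds (x := waistConst κ * s)).div_atTop hlog)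
  rw [← h.liminf_eq]
  refine liminf_le_liminf ?_
  filter_upwards [Ioo_mem_nhdsGT (zero_lt_one (α := ℝ))] with ε hε
  exact le_condMdimRate hT hψcont hN hMN hexp hπ hequiv hκ hε.1 hε.2

end EmbeddedCubes

/-- main technical theorem, conclusion (2): under the hypotheses of the main
technical theorem, every equivariant continuous map `π : (X, T) → (([0,1]^b)^ℤ, σ)`
satisfies `lower-mdim_M(π, T, d) ≥ s − b`. -/
theorem stmt_16 (s : ℝ) (hs : 0 ≤ s) (X : Type) [MetricSpace X] [CompactSpace X]
    (T : X ≃ₜ X) (N M : ℕ → ℕ)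
    (ψ : ∀ n, Cube (M n) → X) (hψcont : ∀ n, Continuous (ψ n))
    (hN : Filter.Tendsto N Filter.atTop Filter.atTop)
    (hMN : Filter.Tendsto (fun n => (M n : ℝ) / (N n : ℝ)) Filter.atTop (𝓝 s))
    (hexp : ∀ (n : ℕ) (x y : Cube (M n)),
      cubeDist x y ≤ dynDist (⇑T) dist (N n) (ψ n x) (ψ n y))
    (b : ℕ) (π : X → FullShift b) (hcont : Continuous π)
    (hequiv : ∀ x, π (T x) = shift (π x)) :
    ((s - (b : ℝ) : ℝ) : EReal) ≤ lowerCondMdimM π (⇑T) dist := by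
  exact le_lowerCondMdimM T.continuous hψcont hN hMN hexp hcont hequiv
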